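/- Let π ∈ ℤ[i] be a primary prime with p = π·π̄ and let χ̃_π be the associated Hecke character of weight one. Then ϖ^{−1}·L(1, χ̃_π) equals: −((1+i)/2)·χ_π(2)·π^{−1}·G_π(χ_π, φ) if p ≡ 13 (mod 16); π^{−1}·G_π(χ_π, Z) if p ≡ 5 (mod 16); χ̄_π(1+i)·π^{−1}·G_π(χ_π, ψ) if p ≡ 1 (mod 16); and −χ̄_π(1+i)·π^{−1}·G_π(χ_π, ψ) if p ≡ 9 (mod 16). -/

import Mathlib

open Complex BigOperators

noncomputable section

/-- The ring of Gaussian integers `ℤ[i]`, realized as a subring of `ℂ`. -/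
def O4 : Subring ℂ := Subring.closure {Complex.I}

/-- `ζ₈ = e^{2πi/8}`, a primitive eighth root of unity. -/
def zeta8 : ℂ := Complex.exp (2 * Real.pi * Complex.I / 8)

/-- The ring `ℤ[ζ₈]`, realized as a subring of `ℂ`. -/
def O8 : Subring ℂ := Subring.closure {zeta8}

/-- The congruence `a ≡ b (mod c)` in `ℤ[i]`. -/
def GCong (a b c : ℂ) : Prop := ∃ d ∈ O4, a - b = c * d

/-- `a` and `b` are coprime in `ℤ[i]`. -/
def GCoprime (a b : ℂ) : Prop := ∃ u ∈ O4, ∃ v ∈ O4, u * a + v * b = 1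

/-- The real period `ϖ = 2∫₀¹ (1−x⁴)^{−1/2} dx`. -/
def varpi : ℝ := 2 * ∫ x in (0:ℝ)..(1:ℝ), (1 - x ^ 4) ^ (-(1:ℝ)/2)

/-- The points of the period lattice `ϖ·ℤ[i]`. -/
def ω4 (m : ℤ × ℤ) : ℂ := (varpi : ℂ) * ((m.1 : ℂ) + (m.2 : ℂ) * Complex.I)

/-- The Weierstrass `℘`-function of the period lattice `ϖ·ℤ[i]`
(so that `℘′² = 4℘³ − 4℘`). -/
def wp4 (u : ℂ) : ℂ :=
  (u ^ 2)⁻¹ + ∑' m : ℤ × ℤ, if m = 0 then 0 else (((u - ω4 m) ^ 2)⁻¹ - ((ω4 m) ^ 2)⁻¹)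

/-- The derivative `℘′` of the Weierstrass `℘`-function of `ϖ·ℤ[i]`. -/
def wp4' (u : ℂ) : ℂ := ∑' m : ℤ × ℤ, (-2) * ((u - ω4 m) ^ 3)⁻¹

/-- The Weierstrass `ζ`-function of the period lattice `ϖ·ℤ[i]`. -/
def wzeta4 (u : ℂ) : ℂ :=
  u⁻¹ + ∑' m : ℤ × ℤ, if m = 0 then 0 else ((u - ω4 m)⁻¹ + (ω4 m)⁻¹ + u * ((ω4 m) ^ 2)⁻¹)

/-- The non-analytic doubly periodic function `Z(u) = ζ(ϖu) − (π/ϖ)·ū`. -/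
def Z4 (u : ℂ) : ℂ :=
  wzeta4 ((varpi : ℂ) * u) - ((Real.pi / varpi : ℝ) : ℂ) * (starRingEnd ℂ) u

/-- The lemniscatic sine `φ(u) = sl((1−i)ϖu) = −2(1−i)·℘(ϖu)/℘′(ϖu)`,
of period lattice `ℤ[i]`. -/
def phi4 (u : ℂ) : ℂ :=
  -2 * (1 - Complex.I) * wp4 ((varpi : ℂ) * u) / wp4' ((varpi : ℂ) * u)

/-- The lemniscatic cosine `ψ(u) = cl((1−i)ϖu) = (℘(ϖu)+i)/(℘(ϖu)−i)`,
of period lattice `ℤ[i]`. -/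
def psi4 (u : ℂ) : ℂ :=
  (wp4 ((varpi : ℂ) * u) + Complex.I) / (wp4 ((varpi : ℂ) * u) - Complex.I)

/-- A residue class character modulo `β` on `ℤ[i]`. -/
structure IsResChar4 (β : ℂ) (χ : ℂ → ℂ) : Prop where
  periodic : ∀ a ∈ O4, ∀ b ∈ O4, GCong a b β → χ a = χ b
  map_mul : ∀ a ∈ O4, ∀ b ∈ O4, χ (a * b) = χ a * χ b
  map_one : χ 1 = 1
  vanish : ∀ a ∈ O4, ¬ GCoprime a β → χ a = 0

/-- The quartic residue character `χ_π = (·/π)₄` modulo a prime `π` with `p = π·π̄`: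
`χ_π(ν)⁴ = 1` and `χ_π(ν) ≡ ν^{(p−1)/4} (mod π)`. -/
structure IsQuarticChar (π : ℂ) (p : ℕ) (χ : ℂ → ℂ) : Prop where
  resChar : IsResChar4 π χ
  quart : ∀ ν ∈ O4, GCoprime ν π → χ ν ^ 4 = 1
  euler : ∀ ν ∈ O4, GCoprime ν π → GCong (χ ν) (ν ^ ((p - 1) / 4)) π

/-- The elliptic Gauss sum `G_π(χ, f) = (1/4)·Σ_{ν ∈ (ℤ[i]/(π))^×} χ(ν)·f(ν/π)`,
computed via the integer representatives `1, …, p−1` of `(ℤ[i]/(π))^× ≅ (ℤ/p)^×`. -/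
def EGS4 (p : ℕ) (χ f : ℂ → ℂ) (π : ℂ) : ℂ :=
  (1/4 : ℂ) * ∑ r ∈ Finset.Icc 1 (p - 1), χ (r : ℂ) * f ((r : ℂ) / π)

/-- `S` is a quarter set of `(ℤ[i]/(π))^×`, i.e. `(ℤ[i]/(π))^× = S ∪ −S ∪ iS ∪ −iS`. -/
def IsQuarterSet (π : ℂ) (S : Finset ℂ) : Prop :=
  (∀ ν ∈ S, ν ∈ O4 ∧ GCoprime ν π) ∧
  (∀ a ∈ O4, GCoprime a π →
    ∃ ν ∈ S, ∃ ε ∈ ({1, -1, Complex.I, -Complex.I} : Set ℂ), GCong a (ε * ν) π) ∧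
  (∀ ν ∈ S, ∀ μ ∈ S, ∀ ε ∈ ({1, -1, Complex.I, -Complex.I} : Set ℂ),
    ∀ ε' ∈ ({1, -1, Complex.I, -Complex.I} : Set ℂ),
      GCong (ε * ν) (ε' * μ) π → ν = μ ∧ ε = ε')

/-- `γ(S)`: if `p ≡ 5 (mod 8)`, the fourth root of unity with
`γ(S) ≡ ∏_{ν∈S} ν (mod π)`; if `p ≡ 1 (mod 8)`, the fourth root of `−1` with
`γ(S) ≡ ∏_{ν∈S} ν (mod Π)` for a fixed prime `Π` of `ℤ[ζ₈]` with `π = Π·Π′`. -/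
def IsGamma4 (π : ℂ) (p : ℕ) (S : Finset ℂ) (γ : ℂ) : Prop :=
  (p % 8 = 5 → γ ^ 4 = 1 ∧ GCong γ (∏ ν ∈ S, ν) π) ∧
  (p % 8 = 1 → γ ^ 4 = -1 ∧
    ∃ P : O8, Prime P ∧ (∃ Q : O8, π = (P : ℂ) * (Q : ℂ)) ∧
      ∃ d ∈ O8, γ - ∏ ν ∈ S, ν = (P : ℂ) * d)

/-- `L` is the value at `s = 1` of the analytic continuation of the Hecke `L`-series
`L(s, χ̃) = Σ_𝔞 χ̃(𝔞)·N𝔞^{−s} = (1/4)·Σ_{ν ∈ ℤ[i]} χ₁(ν)·ν̄·|ν|^{−2s}` attached to the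
weight-one Hecke character `χ̃((ν)) = χ₁(ν)·ν̄` of `ℚ(i)`. -/
def IsLValue4 (χ₁ : ℂ → ℂ) (L : ℂ) : Prop :=
  ∃ F : ℂ → ℂ, DifferentiableOn ℂ F {s : ℂ | 0 < s.re} ∧
    (∀ s : ℂ, 3/2 < s.re →
      F s = (1/4 : ℂ) *
        ∑' ν : O4, χ₁ (ν : ℂ) * (starRingEnd ℂ) (ν : ℂ) *
          ((Complex.normSq (ν : ℂ) : ℂ) ^ (-s))) ∧
    F 1 = L

/-- `T` is a complete residue system modulo `β` in `ℤ[i]`. -/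
def IsCRS4 (β : ℂ) (T : Finset ℂ) : Prop :=
  (∀ a ∈ T, a ∈ O4) ∧ (∀ a ∈ T, ∀ b ∈ T, GCong a b β → a = b) ∧
  (∀ z ∈ O4, ∃ a ∈ T, GCong z a β)

/-- `e^{2πi·Re(z)}`. -/
def eRe4 (z : ℂ) : ℂ := Complex.exp (2 * Real.pi * Complex.I * (z.re : ℂ))

/-- `χ₀`: the character mod `(1+i)³` giving the natural isomorphism
`(ℤ[i]/(1+i)³)^× ≅ W`, i.e. `χ₀(ν) = ε` for `ν ≡ ε (mod (1+i)³)`, `ε ∈ W = {±1, ±i}`. -/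
def IsChi0₄ (χ₀ : ℂ → ℂ) : Prop :=
  IsResChar4 ((1 + Complex.I) ^ 3) χ₀ ∧
    ∀ ε ∈ ({1, -1, Complex.I, -Complex.I} : Set ℂ), χ₀ ε = ε

/-- `χ₀′`: the character mod `(1+i)² = 2i` giving `(ℤ[i]/(2))^× ≅ {±1}`, i.e.
`χ₀′(ν) = δ²` for `ν ≡ δ (mod (1+i)²)`, `δ ∈ {1, i}`. -/
def IsChi0'₄ (χ₀' : ℂ → ℂ) : Prop :=
  IsResChar4 2 χ₀' ∧ χ₀' Complex.I = -1

/-- The classical quartic Gauss sum `G₄(π) = Σ_{r=1}^{p−1} (r/π)₄·e^{2πir/p}`. -/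
def G4sum (p : ℕ) (χ : ℂ → ℂ) : ℂ :=
  ∑ r ∈ Finset.Icc 1 (p - 1), χ (r : ℂ) * Complex.exp (2 * Real.pi * Complex.I * (r : ℂ) / (p : ℂ))

section WeierstrassZeta

open Filter Topology PeriodPair

variable (L : PeriodPair)

/-- The Weierstrass `ζ`-function of a period pair with the term of the lattice point `0` omitted. -/
def zetaExcept (z : ℂ) : ℂ :=
  ∑' l : L.lattice, if l.1 = 0 then 0 else (1 / (z - l) + 1 / l + z / l ^ 2)

/-- The Weierstrass `ζ`-function of a period pair. -/
def zetaW (z : ℂ) : ℂ := 1 / z + zetaExcept L z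

lemma zeta_summand_bound {r : ℝ} {z l : ℂ} (hz : ‖z‖ < r) (h : 2 * r ≤ ‖l‖) :
    ‖1 / (z - l) + 1 / l + z / l ^ 2‖ ≤ 2 * r ^ 2 * ‖l‖ ^ (-3 : ℝ) := by
  have hr : 0 < r := (norm_nonneg z).trans_lt hz
  have hl : 0 < ‖l‖ := by linarith
  have hl0 : l ≠ 0 := norm_pos_iff.mp hl
  have hd : ‖l‖ / 2 ≤ ‖z - l‖ := by
    have := norm_sub_norm_le l z
    rw [norm_sub_rev] at this
    linarith
  have hzl : z - l ≠ 0 := norm_pos_iff.mp (by linarith)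
  have e : 1 / (z - l) + 1 / l + z / l ^ 2 = z ^ 2 / (l ^ 2 * (z - l)) := by
    field_simp
    ring
  rw [e, norm_div, norm_mul, norm_pow, norm_pow]
  have : ‖l‖ ^ (-3 : ℝ) = (‖l‖ ^ 3)⁻¹ := by
    rw [Real.rpow_neg hl.le]; norm_cast
  rw [this, div_le_iff₀ (by positivity)]
  calc ‖z‖ ^ 2 ≤ r ^ 2 := by gcongr
    _ = 2 * r ^ 2 * (‖l‖ ^ 3)⁻¹ * (‖l‖ ^ 2 * (‖l‖ / 2)) := by field_simp
    _ ≤ _ := by gcongr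

lemma hasSumLocallyUniformly_zetaExcept :
    HasSumLocallyUniformly
      (fun (l : L.lattice) (z : ℂ) ↦ if l.1 = 0 then 0 else (1 / (z - l) + 1 / l + z / l ^ 2))
      (zetaExcept L) := by
  refine L.hasSumLocallyUniformly_aux (u := fun r l ↦ 2 * r ^ 2 * ‖l‖ ^ (-3 : ℝ)) _
    (fun _ _ ↦ (ZLattice.summable_norm_rpow _ _ (by simp; norm_num)).mul_left _) fun r hr ↦
    Filter.eventually_atTop.mpr ⟨2 * r, ?_⟩
  rintro _ h s hs l rfl
  split_ifs
  · rw [norm_zero]; positivity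
  · exact zeta_summand_bound hs h

lemma hasDerivAt_zeta_summand {z l : ℂ} (h : z ≠ l) :
    HasDerivAt (fun z ↦ 1 / (z - l) + 1 / l + z / l ^ 2) (-(1 / (z - l) ^ 2 - 1 / l ^ 2)) z := by
  have h' : z - l ≠ 0 := sub_ne_zero.mpr h
  have h1 := (((hasDerivAt_id z).sub_const l).inv h').add_const (1 / l)
  have h2 := h1.add ((hasDerivAt_id z).div_const (l ^ 2))
  convert! h2 using 1
  · ext x; simp [one_div]
  · simp [neg_div]; ring

lemma differentiableOn_zetaExcept :
    DifferentiableOn ℂ (zetaExcept L) (L.lattice \ {0})ᶜ := by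
  refine (hasSumLocallyUniformly_zetaExcept L).hasSumLocallyUniformlyOn.differentiableOn
    (.of_forall fun s ↦ .fun_sum fun i hi ↦ ?_) L.isOpen_compl_lattice_sdiff
  split_ifs with h
  · simp
  · intro z hz
    exact (hasDerivAt_zeta_summand
      (by rintro rfl; simp_all)).differentiableAt.differentiableWithinAt

lemma deriv_zetaExcept {z : ℂ} (hz : z ∈ (L.lattice \ {0} : Set ℂ)ᶜ) :
    deriv (zetaExcept L) z = - L.weierstrassPExcept 0 z := by
  suffices Set.EqOn (deriv (zetaExcept L)) (-(L.weierstrassPExcept 0)) (L.lattice \ {0})ᶜ from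
    this hz
  refine ((hasSumLocallyUniformly_zetaExcept L).tendstoLocallyUniformlyOn.deriv
    (.of_forall fun s ↦ ?_) L.isOpen_compl_lattice_sdiff).unique ?_
  · refine .fun_sum fun i hi ↦ ?_
    split_ifs
    · simp
    · intro z hz
      exact (hasDerivAt_zeta_summand
        (by rintro rfl; simp_all)).differentiableAt.differentiableWithinAt
  · have := (L.hasSumLocallyUniformly_weierstrassPExcept 0).tendstoLocallyUniformlyOn.neg
      (s := (L.lattice \ {0} : Set ℂ)ᶜ)
    refine this.congr ?_
    intro s l hl
    simp only [Function.comp_apply, Pi.neg_apply]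
    rw [deriv_fun_sum, ← Finset.sum_neg_distrib]
    · refine Finset.sum_congr rfl fun x _ ↦ ?_
      split_ifs with h
      · simp
      · exact (hasDerivAt_zeta_summand (by rintro rfl; simp_all)).deriv.symm
    · intro x _
      split_ifs with h
      · simp
      · exact (hasDerivAt_zeta_summand (by rintro rfl; simp_all)).differentiableAt

lemma analyticAt_zetaExcept {z : ℂ} (hz : z ∈ (L.lattice \ {0} : Set ℂ)ᶜ) :
    AnalyticAt ℂ (zetaExcept L) z :=
  (differentiableOn_zetaExcept L).analyticOnNhd L.isOpen_compl_lattice_sdiff z hz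

lemma zetaExcept_neg (z : ℂ) : zetaExcept L (-z) = - zetaExcept L z := by
  simp only [zetaExcept]
  rw [← (Equiv.neg L.lattice).tsum_eq, ← tsum_neg]
  congr with l
  by_cases h : l.1 = 0
  · simp [h]
  · simp only [Equiv.neg_apply, NegMemClass.coe_neg, neg_eq_zero, h, if_false]
    rw [show -z - -l.1 = -(z - l) by ring]
    simp only [one_div, inv_neg, neg_div, even_two.neg_pow]
    ring

lemma zetaW_neg (z : ℂ) : zetaW L (-z) = - zetaW L z := by
  simp only [zetaW, zetaExcept_neg, one_div, inv_neg]
  ring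

lemma weierstrassP_eq_add (z : ℂ) : L.weierstrassP z = 1 / z ^ 2 + L.weierstrassPExcept 0 z := by
  rw [← L.weierstrassPExcept_add 0]
  simp [add_comm]

lemma derivWeierstrassP_eq_add (z : ℂ) :
    L.derivWeierstrassP z = - 2 / z ^ 3 + L.derivWeierstrassPExcept 0 z := by
  rw [← L.derivWeierstrassPExcept_sub 0]
  simp [neg_div]
  ring

lemma hasDerivAt_zetaW {z : ℂ} (hz : z ∉ L.lattice) :
    HasDerivAt (zetaW L) (- L.weierstrassP z) z := by
  have hz0 : z ≠ 0 := by rintro rfl; exact hz (zero_mem _)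
  have hz' : z ∈ (L.lattice \ {0} : Set ℂ)ᶜ := by simp [hz]
  have h1 := (analyticAt_zetaExcept L hz').differentiableAt.hasDerivAt
  rw [deriv_zetaExcept L hz'] at h1
  have h2 := (hasDerivAt_inv hz0).add h1
  convert! h2 using 1
  · ext x; simp [zetaW]
  · rw [weierstrassP_eq_add]; simp; ring

lemma analyticAt_zetaW {z : ℂ} (hz : z ∉ L.lattice) : AnalyticAt ℂ (zetaW L) z := by
  have : DifferentiableOn ℂ (zetaW L) (L.lattice : Set ℂ)ᶜ := fun w hw ↦
    (hasDerivAt_zetaW L hw).differentiableAt.differentiableWithinAt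
  exact this.analyticOnNhd L.isClosed_lattice.isOpen_compl z hz

lemma hasDerivAt_weierstrassP {z : ℂ} (hz : z ∉ L.lattice) :
    HasDerivAt L.weierstrassP (L.derivWeierstrassP z) z := by
  have := (L.analyticOnNhd_weierstrassP z hz).differentiableAt.hasDerivAt
  rwa [L.deriv_weierstrassP] at this

end WeierstrassZeta

section EllipticFunctions

open Filter Topology PeriodPair

variable (L : PeriodPair)

lemma analyticAt_dslope {f : ℂ → ℂ} {a : ℂ} (h : AnalyticAt ℂ f a) :
    AnalyticAt ℂ (dslope f a) a := by
  obtain ⟨p, hp⟩ := h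
  exact ⟨_, hp.has_fpower_series_dslope_fslope⟩

lemma limUnder_eq_of_eventuallyEq {f g : ℂ → ℂ} {x : ℂ} (hg : ContinuousAt g x)
    (h : f =ᶠ[𝓝[≠] x] g) : limUnder (𝓝[≠] x) f = g x :=
  (((hg.tendsto.mono_left nhdsWithin_le_nhds).congr' h.symm)).limUnder_eq

lemma tendsto_add_nhdsNE (x l : ℂ) : Tendsto (· + l) (𝓝[≠] x) (𝓝[≠] (x + l)) := by
  refine tendsto_nhdsWithin_of_tendsto_nhds_of_eventually_within _ ?_ ?_
  · exact ((continuous_add_const l).tendsto x).mono_left nhdsWithin_le_nhds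
  · filter_upwards [self_mem_nhdsWithin] with z hz
    simpa using hz

lemma eventually_nhdsNE_notMem_lattice (x v : ℂ) : ∀ᶠ z in 𝓝[≠] x, z + v ∉ L.lattice := by
  refine (tendsto_add_nhdsNE x v).eventually (p := fun z ↦ z ∉ L.lattice) ?_
  filter_upwards [nhdsWithin_le_nhds (L.compl_lattice_sdiff_singleton_mem_nhds (x + v)),
    self_mem_nhdsWithin] with z hz hz'
  simp_all

/-- Liouville's theorem for elliptic functions whose singularities are all removable. -/
lemma exists_tendsto_const_of_elliptic {f : ℂ → ℂ}
    (hper : ∀ l ∈ L.lattice, ∀ x, ∀ᶠ z in 𝓝[≠] x, f (z + l) = f z)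
    (han : ∀ x, ∃ l ∈ L.lattice, ∃ g, AnalyticAt ℂ g (x + l) ∧ f =ᶠ[𝓝[≠] (x + l)] g) :
    ∃ c, ∀ x, Tendsto f (𝓝[≠] x) (𝓝 c) := by
  have han' : ∀ x, ∃ g, AnalyticAt ℂ g x ∧ f =ᶠ[𝓝[≠] x] g := by
    intro x
    obtain ⟨l, hl, g, hg, hfg⟩ := han x
    refine ⟨fun z ↦ g (z + l), hg.comp (f := (· + l)) (by fun_prop), ?_⟩
    filter_upwards [(tendsto_add_nhdsNE x l).eventually hfg, hper l hl x] with z h1 h2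
    rw [← h1, h2]
  set h : ℂ → ℂ := fun x ↦ limUnder (𝓝[≠] x) f with hh
  have hev : ∀ x g, AnalyticAt ℂ g x → f =ᶠ[𝓝[≠] x] g → h =ᶠ[𝓝 x] g := by
    intro x g hg hfg
    have h1 : ∀ᶠ y in 𝓝[≠] x, h y = g y := by
      have h2 := eventually_eventually_nhdsWithin.mpr hfg
      have h3 := (hg.eventually_analyticAt).filter_mono (nhdsWithin_le_nhds (s := {x}ᶜ))
      filter_upwards [h2, h3, self_mem_nhdsWithin] with y hy hy' hne
      refine limUnder_eq_of_eventuallyEq hy'.continuousAt ?_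
      have : 𝓝[{x}ᶜ] y = 𝓝 y := isOpen_ne.nhdsWithin_eq hne
      rw [this] at hy
      exact hy.filter_mono nhdsWithin_le_nhds
    have h4 : h x = g x := limUnder_eq_of_eventuallyEq hg.continuousAt hfg
    rw [eventually_nhdsWithin_iff] at h1
    filter_upwards [h1] with y hy
    by_cases e : y = x
    · rw [e, h4]
    · exact hy e
  have hdiff : Differentiable ℂ h := by
    intro x
    obtain ⟨g, hg, hfg⟩ := han' x
    exact (hg.congr (hev x g hg hfg).symm).differentiableAt
  have hperh : ∀ z w, w ∈ L.lattice → h (z + w) = h z := by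
    intro z w hw
    obtain ⟨g, hg, hfg⟩ := han' (z + w)
    rw [(hev _ g hg hfg).eq_of_nhds]
    symm
    refine limUnder_eq_of_eventuallyEq (g := fun y ↦ g (y + w))
      (hg.continuousAt.comp (f := (· + w)) (by fun_prop)) ?_
    filter_upwards [(tendsto_add_nhdsNE z w).eventually hfg, hper w hw z] with y h1 h2
    rw [← h1, h2]
  refine ⟨h 0, fun x ↦ ?_⟩
  obtain ⟨g, hg, hfg⟩ := han' x
  have e : h 0 = g x := by
    rw [← (hev x g hg hfg).eq_of_nhds]
    exact hdiff.apply_eq_apply_of_bounded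
      (IsZLattice.isCompact_range_of_periodic L.lattice _ hdiff.continuous hperh).isBounded 0 x
  rw [e]
  exact (hg.continuousAt.tendsto.mono_left nhdsWithin_le_nhds).congr' hfg.symm

lemma isPreconnected_compl_lattice : IsPreconnected (L.lattice : Set ℂ)ᶜ := by
  refine (Set.Countable.isConnected_compl_of_one_lt_rank (by simp) ?_).2
  exact countable_of_Lindelof_of_discrete (X := L.lattice)

lemma weierstrassP_add {l : ℂ} (hl : l ∈ L.lattice) (z : ℂ) :
    L.weierstrassP (z + l) = L.weierstrassP z := L.weierstrassP_add_coe z ⟨l, hl⟩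

lemma derivWeierstrassP_add {l : ℂ} (hl : l ∈ L.lattice) (z : ℂ) :
    L.derivWeierstrassP (z + l) = L.derivWeierstrassP z := L.derivWeierstrassP_add_coe z ⟨l, hl⟩

lemma exists_quasiperiod {l : ℂ} (hl : l ∈ L.lattice) :
    ∃ η : ℂ, ∀ z, z ∉ L.lattice → zetaW L (z + l) = zetaW L z + η := by
  have hmem : ∀ z, z ∉ L.lattice → z + l ∉ L.lattice := fun z hz h ↦
    hz (by simpa using sub_mem h hl)
  have hd : ∀ z ∈ (L.lattice : Set ℂ)ᶜ,
      HasDerivAt (fun z ↦ zetaW L (z + l) - zetaW L z) 0 z := by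
    intro z hz
    have h1 := (hasDerivAt_zetaW L (hmem z hz)).comp_add_const z l
    have h2 := h1.sub (hasDerivAt_zetaW L hz)
    rw [weierstrassP_add L hl, sub_self] at h2
    exact h2
  obtain ⟨η, hη⟩ := L.isClosed_lattice.isOpen_compl.exists_is_const_of_deriv_eq_zero
    (isPreconnected_compl_lattice L)
    (fun z hz ↦ (hd z hz).differentiableAt.differentiableWithinAt)
    (fun z hz ↦ (hd z hz).deriv)
  exact ⟨η, fun z hz ↦ by linear_combination hη z hz⟩

/-- The addition theorem for the Weierstrass `ζ`-function. -/
lemma zetaW_add_sub_zetaW_sub {v u : ℂ} (hv : 2 * v ∉ L.lattice) (hu : u ∉ L.lattice)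
    (huv : u + v ∉ L.lattice) (huv' : u - v ∉ L.lattice) :
    (zetaW L (u + v) - zetaW L (u - v) - 2 * zetaW L v) * (L.weierstrassP u - L.weierstrassP v)
      = - L.derivWeierstrassP v := by
  have hv1 : v ∉ L.lattice := fun h ↦ hv (by rw [two_mul]; exact add_mem h h)
  have hv2 : -v ∉ L.lattice := fun h ↦ hv1 (by simpa using neg_mem h)
  set D : ℂ → ℂ := fun u ↦ zetaW L (u + v) - zetaW L (u - v) - 2 * zetaW L v with hD
  set f : ℂ → ℂ := fun u ↦ D u * (L.weierstrassP u - L.weierstrassP v) + L.derivWeierstrassP v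
    with hf
  have hneg : ∀ u, f (-u) = f u := by
    intro u
    simp only [hf, hD, L.weierstrassP_neg]
    rw [show -u + v = -(u - v) by ring, show -u - v = -(u + v) by ring, zetaW_neg, zetaW_neg]
    ring
  have hper : ∀ l ∈ L.lattice, ∀ x, ∀ᶠ z in 𝓝[≠] x, f (z + l) = f z := by
    intro l hl x
    obtain ⟨η, hη⟩ := exists_quasiperiod L hl
    filter_upwards [eventually_nhdsNE_notMem_lattice L x v,
      eventually_nhdsNE_notMem_lattice L x (-v)] with z h1 h2
    simp only [hf, hD, weierstrassP_add L hl]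
    rw [show z + l + v = z + v + l by ring, show z + l - v = z + -v + l by ring, hη _ h1,
      hη _ h2, ← sub_eq_add_neg]
    ring
  have hDan : ∀ x, x + v ∉ L.lattice → x - v ∉ L.lattice → AnalyticAt ℂ D x := by
    intro x h1 h2
    have a1 : AnalyticAt ℂ (fun u ↦ zetaW L (u + v)) x :=
      (analyticAt_zetaW L h1).comp (f := (· + v)) (by fun_prop)
    have a2 : AnalyticAt ℂ (fun u ↦ zetaW L (u - v)) x :=
      (analyticAt_zetaW L h2).comp (f := (· - v)) (by fun_prop)
    exact (a1.sub a2).sub analyticAt_const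
  -- the singularity at `v`
  have hv_loc : ∃ g, AnalyticAt ℂ g v ∧ f =ᶠ[𝓝[≠] v] g ∧ g v = 0 := by
    refine ⟨fun u ↦ (zetaW L (u + v) - zetaExcept L (u - v) - 2 * zetaW L v) *
      (L.weierstrassP u - L.weierstrassP v) - dslope L.weierstrassP v u + L.derivWeierstrassP v,
      ?_, ?_, ?_⟩
    · have a1 : AnalyticAt ℂ (fun u ↦ zetaW L (u + v)) v :=
        (analyticAt_zetaW L (by rwa [← two_mul])).comp (f := (· + v)) (by fun_prop)
      have a2 : AnalyticAt ℂ (fun u ↦ zetaExcept L (u - v)) v :=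
        (analyticAt_zetaExcept L (by simp)).comp (f := (· - v)) (by fun_prop)
      have a3 := L.analyticOnNhd_weierstrassP v hv1
      have a4 := analyticAt_dslope a3
      fun_prop
    · filter_upwards [self_mem_nhdsWithin] with u hu
      have : u - v ≠ 0 := sub_ne_zero.mpr hu
      simp only [hf, hD]
      rw [dslope_of_ne _ hu, slope_def_field, zetaW, zetaW]
      field_simp
      ring
    · simp [dslope_same]
  obtain ⟨c, hc⟩ := exists_tendsto_const_of_elliptic L hper (by
    intro x
    by_cases h0 : x ∈ L.lattice
    · refine ⟨-x, neg_mem h0, ?_⟩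
      rw [add_neg_cancel]
      have hD0 : AnalyticAt ℂ D 0 := hDan 0 (by simpa) (by simpa)
      have e0 : D 0 = 0 := by
        simp only [hD, zero_add, zero_sub, zetaW_neg]; ring
      have e1 : deriv D 0 = 0 := by
        have d1 : HasDerivAt (fun u ↦ zetaW L (u + v)) (- L.weierstrassP (0 + v)) 0 :=
          (hasDerivAt_zetaW L (by simpa)).comp_add_const 0 v
        have d2 : HasDerivAt (fun u ↦ zetaW L (u - v)) (- L.weierstrassP (0 - v)) 0 :=
          (hasDerivAt_zetaW L (by simpa)).comp_sub_const 0 v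
        have := (d1.sub d2).sub_const (2 * zetaW L v)
        rw [zero_add, zero_sub, L.weierstrassP_neg, sub_self] at this
        exact this.deriv
      refine ⟨fun u ↦ dslope (dslope D 0) 0 u + D u * (L.weierstrassPExcept 0 u -
        L.weierstrassP v) + L.derivWeierstrassP v, ?_, ?_⟩
      · have a1 := analyticAt_dslope (analyticAt_dslope hD0)
        have a2 := L.analyticAt_weierstrassPExcept 0
        fun_prop
      · filter_upwards [self_mem_nhdsWithin] with u hu
        have hu' : u ≠ 0 := hu
        simp only [hf]
        rw [dslope_of_ne _ hu, slope_def_field, dslope_same, dslope_of_ne _ hu, slope_def_field,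
          e0, e1, weierstrassP_eq_add]
        field_simp
        ring
    by_cases h1 : x - v ∈ L.lattice
    · obtain ⟨g, hg, hfg, -⟩ := hv_loc
      exact ⟨-(x - v), neg_mem h1, g, by simpa using hg, by simpa using hfg⟩
    by_cases h2 : x + v ∈ L.lattice
    · obtain ⟨g, hg, hfg, -⟩ := hv_loc
      refine ⟨-(x + v), neg_mem h2, fun z ↦ g (-z), ?_⟩
      rw [show x + -(x + v) = -v by ring]
      refine ⟨AnalyticAt.comp (g := g) (f := fun z ↦ -z) (by simpa using hg) (by fun_prop), ?_⟩
      have : Tendsto (fun z : ℂ ↦ -z) (𝓝[≠] (-v)) (𝓝[≠] v) := by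
        refine tendsto_nhdsWithin_of_tendsto_nhds_of_eventually_within _ ?_ ?_
        · simpa using (continuous_neg.tendsto (-v)).mono_left nhdsWithin_le_nhds
        · filter_upwards [self_mem_nhdsWithin] with z hz
          exact fun h ↦ hz (by simpa [neg_eq_iff_eq_neg] using h)
      filter_upwards [this.eventually hfg] with z hz
      rw [← hz, hneg]
    · refine ⟨0, zero_mem _, f, ?_, EventuallyEq.rfl⟩
      rw [add_zero]
      have := hDan x h2 h1
      have := L.analyticOnNhd_weierstrassP x h0
      fun_prop)
  have hc0 : c = 0 := by
    obtain ⟨g, hg, hfg, hg0⟩ := hv_loc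
    rw [← hg0]
    exact tendsto_nhds_unique (hc v)
      ((hg.continuousAt.tendsto.mono_left nhdsWithin_le_nhds).congr' hfg.symm)
  have hcont : ContinuousAt f u := by
    have := hDan u huv huv'
    have := L.analyticOnNhd_weierstrassP u hu
    have : AnalyticAt ℂ f u := by fun_prop
    exact this.continuousAt
  have := tendsto_nhds_unique (hcont.tendsto.mono_left nhdsWithin_le_nhds) (hc u)
  rw [hc0] at this
  linear_combination this

end EllipticFunctions

section Values

open Filter Topology PeriodPair

variable (L : PeriodPair)

lemma tendsto_nhdsNE_zero {f : ℂ → ℂ} (hf : Continuous f) {c : ℂ} (h0 : f 0 = c) :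
    Tendsto f (𝓝[≠] 0) (𝓝 c) :=
  h0 ▸ (hf.tendsto 0).mono_left nhdsWithin_le_nhds

lemma tendsto_mul_zetaW_of_notMem {w : ℂ} (hw : w ∉ L.lattice) :
    Tendsto (fun t ↦ t * zetaW L (t + w)) (𝓝[≠] 0) (𝓝 0) := by
  have h1 : ContinuousAt (fun t ↦ t * zetaW L (t + w)) 0 := by
    have : ContinuousAt (fun t ↦ zetaW L (t + w)) 0 :=
      ContinuousAt.comp (g := zetaW L) (f := (· + w))
        (by simpa using (analyticAt_zetaW L hw).continuousAt) (by fun_prop)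
    fun_prop
  simpa using h1.tendsto.mono_left nhdsWithin_le_nhds

lemma tendsto_mul_zetaW_zero : Tendsto (fun t ↦ t * zetaW L t) (𝓝[≠] 0) (𝓝 1) := by
  have h1 : ContinuousAt (fun t ↦ 1 + t * zetaExcept L t) 0 := by
    have := (analyticAt_zetaExcept L (z := 0) (by simp)).continuousAt
    fun_prop
  have h2 : Tendsto (fun t ↦ 1 + t * zetaExcept L t) (𝓝[≠] 0) (𝓝 1) := by
    simpa using h1.tendsto.mono_left nhdsWithin_le_nhds
  refine h2.congr' ?_
  filter_upwards [self_mem_nhdsWithin] with t ht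
  have : t ≠ 0 := ht
  rw [zetaW]
  field_simp

lemma tendsto_mul_zetaW_of_mem {w : ℂ} (hw : w ∈ L.lattice) :
    Tendsto (fun t ↦ t * zetaW L (t + w)) (𝓝[≠] 0) (𝓝 1) := by
  obtain ⟨η, hη⟩ := exists_quasiperiod L hw
  have h1 : Tendsto (fun t : ℂ ↦ t * η) (𝓝[≠] 0) (𝓝 0) :=
    tendsto_nhdsNE_zero (by fun_prop) (by simp)
  have := (tendsto_mul_zetaW_zero L).add h1
  rw [add_zero] at this
  refine this.congr' ?_
  filter_upwards [eventually_nhdsNE_notMem_lattice L 0 0] with t ht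
  rw [hη t (by simpa using ht), mul_add]

lemma tendsto_sq_mul_weierstrassP :
    Tendsto (fun t ↦ t ^ 2 * L.weierstrassP t) (𝓝[≠] 0) (𝓝 1) := by
  have h1 : ContinuousAt (fun t ↦ 1 + t ^ 2 * L.weierstrassPExcept 0 t) 0 := by
    have := (L.analyticAt_weierstrassPExcept 0).continuousAt
    fun_prop
  have h2 : Tendsto (fun t ↦ 1 + t ^ 2 * L.weierstrassPExcept 0 t) (𝓝[≠] 0) (𝓝 1) := by
    simpa using h1.tendsto.mono_left nhdsWithin_le_nhds
  refine h2.congr' ?_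
  filter_upwards [self_mem_nhdsWithin] with t ht
  have : t ≠ 0 := ht
  rw [weierstrassP_eq_add]
  field_simp

lemma tendsto_cube_mul_derivWeierstrassP :
    Tendsto (fun t ↦ t ^ 3 * L.derivWeierstrassP t) (𝓝[≠] 0) (𝓝 (-2)) := by
  have h1 : ContinuousAt (fun t ↦ -2 + t ^ 3 * L.derivWeierstrassPExcept 0 t) 0 := by
    have := (analyticAt_derivWeierstrassPExcept L 0).continuousAt
    fun_prop
  have h2 : Tendsto (fun t ↦ -2 + t ^ 3 * L.derivWeierstrassPExcept 0 t) (𝓝[≠] 0) (𝓝 (-2)) := by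
    simpa using h1.tendsto.mono_left nhdsWithin_le_nhds
  refine h2.congr' ?_
  filter_upwards [self_mem_nhdsWithin] with t ht
  have : t ≠ 0 := ht
  rw [derivWeierstrassP_eq_add]
  field_simp

lemma not_eventually_weierstrassP_eq {x : ℂ} (hx : x ∉ L.lattice) (c : ℂ) :
    ¬ ∀ᶠ t in 𝓝[≠] 0, L.weierstrassP (t + x) = c := by
  intro h
  have h' : ∀ᶠ u in 𝓝[≠] x, L.weierstrassP u = c := by
    have := (tendsto_add_nhdsNE x (-x)).eventually (p := fun t ↦ L.weierstrassP (t + x) = c)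
      (by simpa using h)
    simpa using this
  have heq := L.analyticOnNhd_weierstrassP.eqOn_of_preconnected_of_frequently_eq
    (g := fun _ ↦ c) (fun _ _ ↦ analyticAt_const) (isPreconnected_compl_lattice L) hx h'.frequently
  have h2 : Tendsto (fun t : ℂ ↦ t ^ 2 * c) (𝓝[≠] 0) (𝓝 0) :=
    tendsto_nhdsNE_zero (by fun_prop) (by simp)
  have h3 : Tendsto (fun t : ℂ ↦ t ^ 2 * c) (𝓝[≠] 0) (𝓝 1) := by
    refine (tendsto_sq_mul_weierstrassP L).congr' ?_
    filter_upwards [eventually_nhdsNE_notMem_lattice L 0 0] with t ht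
    rw [heq (show t ∈ (L.lattice : Set ℂ)ᶜ by simpa using ht)]
  exact zero_ne_one (tendsto_nhds_unique h2 h3)

lemma zetaW_add_add_zetaW_sub {v u : ℂ} (hu : 2 * u ∉ L.lattice) (hv : v ∉ L.lattice)
    (huv : u + v ∉ L.lattice) (huv' : u - v ∉ L.lattice) :
    (zetaW L (u + v) + zetaW L (u - v) - 2 * zetaW L u) * (L.weierstrassP u - L.weierstrassP v)
      = L.derivWeierstrassP u := by
  have h := zetaW_add_sub_zetaW_sub L hu hv (by rwa [add_comm])
    (fun h ↦ huv' (by simpa using neg_mem h))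
  rw [← neg_sub u v, zetaW_neg, add_comm v u] at h
  linear_combination -h

lemma weierstrassP_ne {v w : ℂ} (hv : v ∉ L.lattice) (hw : w ∉ L.lattice)
    (hvw : v + w ∉ L.lattice) (hvw' : v - w ∉ L.lattice) :
    L.weierstrassP v ≠ L.weierstrassP w := by
  intro heq
  have hv' : -v ∉ L.lattice := fun h ↦ hv (by simpa using neg_mem h)
  apply not_eventually_weierstrassP_eq L hv' (L.weierstrassP v)
  have t1 := tendsto_mul_zetaW_zero L
  have t2 : ∃ k : ℂ, 1 + k ≠ 0 ∧
      Tendsto (fun t ↦ t * zetaW L (t + -(2 * v))) (𝓝[≠] 0) (𝓝 k) := by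
    by_cases h : 2 * v ∈ L.lattice
    · exact ⟨1, by norm_num, tendsto_mul_zetaW_of_mem L (neg_mem h)⟩
    · exact ⟨0, by norm_num,
        tendsto_mul_zetaW_of_notMem L (fun h' ↦ h (by simpa using neg_mem h'))⟩
  obtain ⟨k, hk, t2⟩ := t2
  have t3 := tendsto_mul_zetaW_of_notMem L (w := -v + w) (fun h ↦ hvw' (by
    simpa [sub_eq_add_neg, add_comm] using neg_mem h))
  have t4 := tendsto_mul_zetaW_of_notMem L (w := -(v + w)) (fun h ↦ hvw (by
    simpa using neg_mem h))
  have hev := ((t1.add t2).sub (t3.add t4)).eventually_ne (b₂ := 0) (by simpa using hk)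
  have h2 : ∀ᶠ t in 𝓝[≠] (0 : ℂ), 2 * (t + -v) ∉ L.lattice := by
    have hcont : Tendsto (fun t : ℂ ↦ 2 * (t + -v)) (𝓝[≠] 0) (𝓝[≠] (2 * (0 + -v))) := by
      refine tendsto_nhdsWithin_of_tendsto_nhds_of_eventually_within _ ?_ ?_
      · exact ((by fun_prop : Continuous fun t : ℂ ↦ 2 * (t + -v)).tendsto 0).mono_left
          nhdsWithin_le_nhds
      · filter_upwards [self_mem_nhdsWithin] with z hz
        have hz' : z ≠ 0 := hz
        simp only [Set.mem_compl_iff, Set.mem_singleton_iff, mul_eq_mul_left_iff]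
        simp [hz']
    have := eventually_nhdsNE_notMem_lattice L (2 * (0 + -v)) 0
    simp only [add_zero] at this
    exact hcont.eventually this
  filter_upwards [hev, h2, eventually_nhdsNE_notMem_lattice L 0 0,
    eventually_nhdsNE_notMem_lattice L 0 (-(2 * v)), eventually_nhdsNE_notMem_lattice L 0 (-v + w),
    eventually_nhdsNE_notMem_lattice L 0 (-(v + w))] with t h1 h2 h3 h4 h5 h6
  have a1 := zetaW_add_add_zetaW_sub L (v := v) (u := t + -v) h2 hv (by simpa using h3)
    (by rwa [show t + -v - v = t + -(2 * v) by ring])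
  have a2 := zetaW_add_add_zetaW_sub L (v := w) (u := t + -v) h2 hw
    (by rwa [add_assoc]) (by rwa [show t + -v - w = t + -(v + w) by ring])
  rw [show t + -v + v = t by ring, show t + -v - v = t + -(2 * v) by ring] at a1
  rw [show t + -v + w = t + (-v + w) by ring, show t + -v - w = t + -(v + w) by ring, ← heq] at a2
  refine sub_eq_zero.mp ((mul_eq_zero.mp ?_).resolve_left h1)
  linear_combination t * (a1 - a2)

lemma derivWeierstrassP_ne_zero {v : ℂ} (hv : 2 * v ∉ L.lattice) :
    L.derivWeierstrassP v ≠ 0 := by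
  intro h0
  have hv1 : v ∉ L.lattice := fun h ↦ hv (by rw [two_mul]; exact add_mem h h)
  apply not_eventually_weierstrassP_eq L hv1 (L.weierstrassP v)
  have t1 := tendsto_mul_zetaW_zero L
  have t2 := tendsto_mul_zetaW_of_notMem L hv
  have t3 : Tendsto (fun t : ℂ ↦ t * (2 * zetaW L v)) (𝓝[≠] 0) (𝓝 0) :=
    tendsto_nhdsNE_zero (by fun_prop) (by simp)
  have hev := ((t2.sub t1).sub t3).eventually_ne (b₂ := 0) (by simp)
  filter_upwards [hev, eventually_nhdsNE_notMem_lattice L 0 0,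
    eventually_nhdsNE_notMem_lattice L 0 v,
    eventually_nhdsNE_notMem_lattice L 0 (2 * v)] with t h1 h2 h3 h4
  have a1 := zetaW_add_sub_zetaW_sub L (v := v) (u := t + v) hv h3
    (by rwa [show t + v + v = t + 2 * v by ring]) (by simpa using h2)
  rw [h0, show t + v + v = t + 2 * v by ring, add_sub_cancel_right, neg_zero] at a1
  refine sub_eq_zero.mp ((mul_eq_zero.mp ?_).resolve_left h1)
  linear_combination t * a1

end Values

section SquareLattice

open Filter Topology PeriodPair

/-- The period pair `(t, ti)` of a square lattice. -/
def sqPair (t : ℝ) (ht : 0 < t) : PeriodPair where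
  ω₁ := t
  ω₂ := t * I
  indep := by
    refine LinearIndependent.pair_iff.mpr fun a b h ↦ ?_
    have h1 := congrArg re h
    have h2 := congrArg im h
    simp at h1 h2
    exact ⟨h1.resolve_right ht.ne', h2.resolve_right ht.ne'⟩

variable {t : ℝ} (ht : 0 < t)

lemma mem_sqPair {z : ℂ} :
    z ∈ (sqPair t ht).lattice ↔ ∃ m n : ℤ, z = t * (m + n * I) := by
  rw [mem_lattice]
  refine exists₂_congr fun m n ↦ ?_
  simp only [sqPair]
  constructor
  · rintro rfl; ring
  · rintro rfl; ring

lemma mul_mem_sqPair {z : ℂ} :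
    t * z ∈ (sqPair t ht).lattice ↔ ∃ m n : ℤ, z = m + n * I := by
  rw [mem_sqPair]
  have : (t : ℂ) ≠ 0 := by exact_mod_cast ht.ne'
  simp [this]

lemma notMem_sqPair_of_re {z : ℂ} (h0 : 0 < z.re) (h1 : z.re < t) :
    z ∉ (sqPair t ht).lattice := by
  rw [mem_sqPair]
  rintro ⟨m, n, rfl⟩
  simp at h0 h1
  have h3 : (0 : ℝ) < m := (mul_pos_iff_of_pos_left ht).mp h0
  have h4 : (m : ℝ) < 1 := by nlinarith
  norm_cast at h3 h4
  lia

lemma notMem_sqPair_of_im {z : ℂ} (h0 : 0 < z.im) (h1 : z.im < t) :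
    z ∉ (sqPair t ht).lattice := by
  rw [mem_sqPair]
  rintro ⟨m, n, rfl⟩
  simp at h0 h1
  have h3 : (0 : ℝ) < n := (mul_pos_iff_of_pos_left ht).mp h0
  have h4 : (n : ℝ) < 1 := by nlinarith
  norm_cast at h3 h4
  lia

lemma I_mul_mem_sqPair {z : ℂ} :
    I * z ∈ (sqPair t ht).lattice ↔ z ∈ (sqPair t ht).lattice := by
  simp only [mem_sqPair]
  constructor
  · rintro ⟨m, n, h⟩
    refine ⟨n, -m, ?_⟩
    push_cast
    linear_combination -I * h + (z - t * n) * I_sq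
  · rintro ⟨m, n, h⟩
    refine ⟨-n, m, ?_⟩
    push_cast
    linear_combination I * h + t * n * I_sq

lemma conj_mem_sqPair {z : ℂ} :
    (starRingEnd ℂ) z ∈ (sqPair t ht).lattice ↔ z ∈ (sqPair t ht).lattice := by
  have key : ∀ z ∈ (sqPair t ht).lattice, (starRingEnd ℂ) z ∈ (sqPair t ht).lattice := by
    intro z hz
    obtain ⟨m, n, rfl⟩ := (mem_sqPair ht).mp hz
    exact (mem_sqPair ht).mpr ⟨m, -n, by simp⟩
  exact ⟨fun h ↦ by simpa using key _ h, key z⟩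

/-- Multiplication by `i` on a square lattice. -/
def sqRot : (sqPair t ht).lattice ≃ (sqPair t ht).lattice :=
  (Equiv.mulLeft₀ I I_ne_zero).subtypeEquiv fun _ ↦ (I_mul_mem_sqPair ht).symm

/-- Complex conjugation on a square lattice. -/
def sqConj : (sqPair t ht).lattice ≃ (sqPair t ht).lattice :=
  (starRingAut : ℂ ≃+* ℂ).toEquiv.subtypeEquiv fun _ ↦ (conj_mem_sqPair ht).symm

@[simp] lemma sqRot_coe (l : (sqPair t ht).lattice) : (sqRot ht l : ℂ) = I * l := rfl

@[simp] lemma sqConj_coe (l : (sqPair t ht).lattice) :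
    (sqConj ht l : ℂ) = (starRingEnd ℂ) l := rfl

lemma weierstrassP_I_mul (z : ℂ) :
    (sqPair t ht).weierstrassP (I * z) = - (sqPair t ht).weierstrassP z := by
  simp only [weierstrassP]
  rw [← (sqRot ht).tsum_eq, ← tsum_neg]
  congr with l
  simp only [sqRot_coe, ← mul_sub, mul_pow, I_sq]
  simp only [one_div, neg_mul, one_mul, inv_neg]
  ring

lemma derivWeierstrassP_I_mul (z : ℂ) :
    (sqPair t ht).derivWeierstrassP (I * z) = I * (sqPair t ht).derivWeierstrassP z := by
  simp only [derivWeierstrassP]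
  rw [← (sqRot ht).tsum_eq, mul_neg, ← tsum_mul_left]
  congr 2 with l
  simp only [sqRot_coe, ← mul_sub, mul_pow, I_pow_three, div_eq_mul_inv, mul_inv, inv_neg, inv_I]
  ring

lemma weierstrassP_conj (z : ℂ) :
    (sqPair t ht).weierstrassP ((starRingEnd ℂ) z)
      = (starRingEnd ℂ) ((sqPair t ht).weierstrassP z) := by
  simp only [weierstrassP]
  rw [← (sqConj ht).tsum_eq, conj_tsum]
  congr with l
  simp

lemma derivWeierstrassP_conj (z : ℂ) :
    (sqPair t ht).derivWeierstrassP ((starRingEnd ℂ) z)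
      = (starRingEnd ℂ) ((sqPair t ht).derivWeierstrassP z) := by
  simp only [derivWeierstrassP]
  rw [← (sqConj ht).tsum_eq, map_neg, conj_tsum]
  congr 2 with l
  simp [map_ofNat]

lemma g₃_sqPair : (sqPair t ht).g₃ = 0 := by
  have : (sqPair t ht).G 6 = 0 := by
    rw [← CharZero.eq_neg_self_iff, G, ← tsum_neg, ← (sqRot ht).tsum_eq]
    congr with l
    have : I ^ 6 = -1 := by rw [show 6 = 2 * 3 by norm_num, pow_mul, I_sq]; norm_num
    simp [mul_pow, this]
  simp [PeriodPair.g₃, this]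

lemma derivWeierstrassP_sqPair_sq {z : ℂ} (hz : z ∉ (sqPair t ht).lattice) :
    (sqPair t ht).derivWeierstrassP z ^ 2 = 4 * (sqPair t ht).weierstrassP z ^ 3
      - (sqPair t ht).g₂ * (sqPair t ht).weierstrassP z := by
  rw [derivWeierstrassP_sq _ z hz, g₃_sqPair, sub_zero]

lemma derivWeierstrassP_half (L : PeriodPair) {v : ℂ} (hv : 2 * v ∈ L.lattice) :
    L.derivWeierstrassP v = 0 := by
  have h := derivWeierstrassP_add L hv (-v)
  rw [L.derivWeierstrassP_neg, show -v + 2 * v = v by ring] at h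
  exact CharZero.eq_neg_self_iff.mp h

lemma ofReal_mem_sqPair : (t : ℂ) ∈ (sqPair t ht).lattice :=
  (mem_sqPair ht).mpr ⟨1, 0, by simp⟩

lemma ofReal_mul_I_mem_sqPair : (t * I : ℂ) ∈ (sqPair t ht).lattice :=
  (mem_sqPair ht).mpr ⟨0, 1, by simp⟩

lemma weierstrassP_diag_half : (sqPair t ht).weierstrassP (t * ((1 + I) / 2)) = 0 := by
  have h := weierstrassP_I_mul ht (t * ((1 + I) / 2))
  rw [show I * (t * ((1 + I) / 2)) = t * ((1 + I) / 2) + -t by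
    linear_combination (t / 2 : ℂ) * I_sq,
    weierstrassP_add _ (neg_mem (ofReal_mem_sqPair ht))] at h
  exact CharZero.eq_neg_self_iff.mp h

lemma weierstrassP_I_half :
    (sqPair t ht).weierstrassP (t * (I / 2)) = -(sqPair t ht).weierstrassP (t / 2) := by
  rw [← weierstrassP_I_mul]
  congr 1
  ring

lemma weierstrassP_ne_zero_of_im {z : ℂ} (h0 : -(t / 2) < z.im) (h1 : z.im < t / 2)
    (hz : z ∉ (sqPair t ht).lattice) :
    (sqPair t ht).weierstrassP z ≠ 0 := by
  rw [← weierstrassP_diag_half ht]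
  have him : (t * ((1 + I) / 2) : ℂ).im = t / 2 := by
    simp; ring
  refine weierstrassP_ne _ hz (notMem_sqPair_of_im ht ?_ ?_) (notMem_sqPair_of_im ht ?_ ?_) ?_
  · rw [him]; linarith
  · rw [him]; linarith
  · rw [add_im, him]; linarith
  · rw [add_im, him]; linarith
  · intro h
    refine notMem_sqPair_of_im ht ?_ ?_ (neg_mem h) <;>
    · rw [neg_im, sub_im, him]; linarith

lemma g₂_sqPair : (sqPair t ht).g₂ = 4 * (sqPair t ht).weierstrassP (t / 2) ^ 2 := by
  have hre : (t / 2 : ℂ).re = t / 2 := by simp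
  have hm : (t / 2 : ℂ) ∉ (sqPair t ht).lattice := by
    refine notMem_sqPair_of_re ht ?_ ?_ <;> rw [hre] <;> linarith
  have h := derivWeierstrassP_sqPair_sq ht hm
  rw [derivWeierstrassP_half _ (by simpa [mul_div_cancel₀] using ofReal_mem_sqPair ht)] at h
  have hne : (sqPair t ht).weierstrassP (t / 2) ≠ 0 :=
    weierstrassP_ne_zero_of_im ht (by simp [ht]) (by simp [ht]) hm
  apply mul_right_cancel₀ hne
  linear_combination h

end SquareLattice

section Positivity

open Filter Topology PeriodPair

lemma pos_of_ne_zero_of_tendsto {g : ℝ → ℝ} {b c : ℝ} {n : ℕ} (hc : 0 < c)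
    (hg : ContinuousOn g (Set.Ioo 0 b)) (hne : ∀ x ∈ Set.Ioo 0 b, g x ≠ 0)
    (hlim : Tendsto (fun x ↦ x ^ n * g x) (𝓝[>] 0) (𝓝 c)) {x : ℝ} (hx : x ∈ Set.Ioo 0 b) :
    0 < g x := by
  by_contra! hneg
  obtain ⟨y, hy, hy'⟩ : ∃ y, 0 < y ^ n * g y ∧ y ∈ Set.Ioo 0 b :=
    ((hlim.eventually (lt_mem_nhds hc)).and (Ioo_mem_nhdsGT (hx.1.trans hx.2))).exists
  have hgy : 0 < g y := (mul_pos_iff_of_pos_left (pow_pos hy'.1 n)).mp hy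
  obtain ⟨z, hz, hz0⟩ := isPreconnected_Ioo.intermediate_value hx hy' hg ⟨hneg, hgy.le⟩
  exact hne z hz hz0

variable {t : ℝ} (ht : 0 < t)

lemma tendsto_ofReal_mul_nhdsNE {w : ℂ} (hw : w ≠ 0) :
    Tendsto (fun x : ℝ ↦ (x * w : ℂ)) (𝓝[>] 0) (𝓝[≠] 0) := by
  refine tendsto_nhdsWithin_of_tendsto_nhds_of_eventually_within _ ?_ ?_
  · have : Continuous fun x : ℝ ↦ (x * w : ℂ) := by fun_prop
    simpa using (this.tendsto 0).mono_left nhdsWithin_le_nhds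
  · filter_upwards [self_mem_nhdsWithin] with x hx
    have : (x : ℂ) ≠ 0 := by exact_mod_cast (ne_of_gt hx)
    simp [this, hw]

lemma ofReal_notMem_sqPair {x : ℝ} (hx : x ∈ Set.Ioo 0 t) : (x : ℂ) ∉ (sqPair t ht).lattice :=
  notMem_sqPair_of_re ht (by simpa using hx.1) (by simpa using hx.2)

lemma weierstrassP_ofReal (x : ℝ) :
    (((sqPair t ht).weierstrassP x).re : ℂ) = (sqPair t ht).weierstrassP x := by
  rw [← conj_eq_iff_re, ← weierstrassP_conj, conj_ofReal]

lemma derivWeierstrassP_ofReal (x : ℝ) :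
    (((sqPair t ht).derivWeierstrassP x).re : ℂ) = (sqPair t ht).derivWeierstrassP x := by
  rw [← conj_eq_iff_re, ← derivWeierstrassP_conj, conj_ofReal]

lemma hasDerivAt_weierstrassP_ofReal {x : ℝ} (hx : x ∈ Set.Ioo 0 t) :
    HasDerivAt (fun x : ℝ ↦ ((sqPair t ht).weierstrassP x).re)
      ((sqPair t ht).derivWeierstrassP x).re x :=
  (hasDerivAt_weierstrassP _ (ofReal_notMem_sqPair ht hx)).real_of_complex

lemma continuousOn_weierstrassP_ofReal :
    ContinuousOn (fun x : ℝ ↦ ((sqPair t ht).weierstrassP x).re) (Set.Ioo 0 t) :=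
  fun _ hx ↦ (hasDerivAt_weierstrassP_ofReal ht hx).continuousAt.continuousWithinAt

lemma continuousAt_derivWeierstrassP {L : PeriodPair} {z : ℂ} (hz : z ∉ L.lattice) :
    ContinuousAt L.derivWeierstrassP z := by
  have h := L.analyticOnNhd_weierstrassP.deriv z hz
  rw [L.deriv_weierstrassP] at h
  exact h.continuousAt

lemma tendsto_sq_mul_weierstrassP_ofReal :
    Tendsto (fun x : ℝ ↦ x ^ 2 * ((sqPair t ht).weierstrassP x).re) (𝓝[>] 0) (𝓝 1) := by
  have h := (tendsto_sq_mul_weierstrassP (sqPair t ht)).comp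
    (tendsto_ofReal_mul_nhdsNE one_ne_zero)
  have h' := (continuous_re.tendsto _).comp h
  rw [one_re] at h'
  refine h'.congr fun x ↦ ?_
  simp only [Function.comp_apply, mul_one]
  rw [← weierstrassP_ofReal]
  norm_cast

lemma weierstrassP_ofReal_pos {x : ℝ} (hx : x ∈ Set.Ioo 0 t) :
    0 < ((sqPair t ht).weierstrassP x).re := by
  refine pos_of_ne_zero_of_tendsto one_pos (continuousOn_weierstrassP_ofReal ht) ?_
    (tendsto_sq_mul_weierstrassP_ofReal ht) hx
  intro y hy h
  refine weierstrassP_ne_zero_of_im ht (z := y) (by simp [ht]) (by simp [ht])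
    (ofReal_notMem_sqPair ht hy) ?_
  rw [← weierstrassP_ofReal, h, ofReal_zero]

lemma weierstrassP_half_lt {x : ℝ} (hx : x ∈ Set.Ioo 0 (t / 2)) :
    ((sqPair t ht).weierstrassP (t / 2 : ℝ)).re < ((sqPair t ht).weierstrassP x).re := by
  rw [← sub_pos]
  have hsub : Set.Ioo 0 (t / 2) ⊆ Set.Ioo 0 t := Set.Ioo_subset_Ioo_right (by linarith)
  refine pos_of_ne_zero_of_tendsto (n := 2) (c := 1) one_pos
    (g := fun x : ℝ ↦ ((sqPair t ht).weierstrassP x).re -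
      ((sqPair t ht).weierstrassP (t / 2 : ℝ)).re)
    (((continuousOn_weierstrassP_ofReal ht).mono hsub).sub continuousOn_const) ?_ ?_ hx
  · intro y hy h
    refine weierstrassP_ne (sqPair t ht) (v := y) (w := (t / 2 : ℝ))
      (ofReal_notMem_sqPair ht (hsub hy)) (ofReal_notMem_sqPair ht ⟨by linarith, by linarith⟩)
      ?_ ?_ ?_
    · rw [← ofReal_add]
      exact ofReal_notMem_sqPair ht ⟨by linarith [hy.1], by linarith [hy.2]⟩
    · rw [← neg_mem_iff, neg_sub, ← ofReal_sub]
      exact ofReal_notMem_sqPair ht ⟨by linarith [hy.2], by linarith [hy.1]⟩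
    · rw [← weierstrassP_ofReal, ← weierstrassP_ofReal ht (t / 2),
        sub_eq_zero.mp h]
  · have h : Tendsto (fun x : ℝ ↦ x ^ 2 * ((sqPair t ht).weierstrassP (t / 2 : ℝ)).re)
        (𝓝[>] 0) (𝓝 0) := by
      have : Continuous fun x : ℝ ↦ x ^ 2 * ((sqPair t ht).weierstrassP (t / 2 : ℝ)).re := by
        fun_prop
      simpa using (this.tendsto 0).mono_left nhdsWithin_le_nhds
    have h2 := (tendsto_sq_mul_weierstrassP_ofReal ht).sub h
    rw [sub_zero] at h2
    exact h2.congr fun x ↦ by ring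

lemma derivWeierstrassP_ofReal_neg {x : ℝ} (hx : x ∈ Set.Ioo 0 (t / 2)) :
    ((sqPair t ht).derivWeierstrassP x).re < 0 := by
  rw [← neg_pos]
  refine pos_of_ne_zero_of_tendsto (n := 3) (c := 2) (b := t / 2) two_pos
    (g := fun x : ℝ ↦ -((sqPair t ht).derivWeierstrassP x).re) ?_ ?_ ?_ hx
  · intro y hy
    have h := continuousAt_derivWeierstrassP
      (ofReal_notMem_sqPair ht (x := y) ⟨hy.1, by linarith [hy.2]⟩)
    exact ((continuous_re.continuousAt.comp
      (h.comp continuous_ofReal.continuousAt)).neg).continuousWithinAt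
  · intro y hy h
    refine derivWeierstrassP_ne_zero (sqPair t ht) (v := y) ?_ ?_
    · rw [show (2 * y : ℂ) = (2 * y : ℝ) by push_cast; rfl]
      exact ofReal_notMem_sqPair ht ⟨by linarith [hy.1], by linarith [hy.2]⟩
    · rw [← derivWeierstrassP_ofReal, neg_eq_zero.mp h, ofReal_zero]
  · have h := (tendsto_cube_mul_derivWeierstrassP (sqPair t ht)).comp
      (tendsto_ofReal_mul_nhdsNE one_ne_zero)
    have h' := ((continuous_re.tendsto _).comp h).neg
    simp only [neg_re, re_ofNat, neg_neg] at h'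
    refine h'.congr fun x ↦ ?_
    simp only [Function.comp_apply, mul_one]
    rw [← derivWeierstrassP_ofReal]
    norm_cast
    simp

end Positivity

section Lemniscate

open Filter Topology PeriodPair MeasureTheory

lemma intervalIntegrable_lemniscate :
    IntervalIntegrable (fun x : ℝ ↦ (1 - x ^ 4) ^ (-(1:ℝ)/2)) volume 0 1 := by
  have h1 : IntervalIntegrable (fun x : ℝ ↦ x ^ (-(1:ℝ)/2)) volume 0 1 :=
    intervalIntegral.intervalIntegrable_rpow' (by norm_num)
  have h2 := (h1.comp_sub_left 1).symm
  simp only [sub_zero, sub_self] at h2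
  refine h2.mono_fun (Measurable.aestronglyMeasurable (by fun_prop)) ?_
  refine (ae_restrict_iff' measurableSet_uIoc).mpr (.of_forall fun x hx ↦ ?_)
  rw [Set.uIoc_of_le zero_le_one] at hx
  have h4 : x ^ 4 ≤ x := by
    have := pow_le_pow_of_le_one hx.1.le hx.2 (show 1 ≤ 4 by norm_num)
    simpa using this
  have h5 : 0 ≤ 1 - x ^ 4 := by linarith [hx.2]
  beta_reduce
  rw [Real.norm_of_nonneg (Real.rpow_nonneg h5 _),
    Real.norm_of_nonneg (Real.rpow_nonneg (by linarith [hx.2]) _)]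
  rcases hx.2.lt_or_eq with h | rfl
  · exact Real.rpow_le_rpow_of_nonpos (by linarith) (by linarith) (by norm_num)
  · norm_num

/-- The lemniscatic arc length integral. -/
def arcsl (x : ℝ) : ℝ := ∫ y in (0:ℝ)..x, (1 - y ^ 4) ^ (-(1:ℝ)/2)

lemma varpi_eq : varpi = 2 * arcsl 1 := rfl

lemma varpi_pos : 0 < varpi := by
  refine mul_pos two_pos (intervalIntegral.intervalIntegral_pos_of_pos_on
    intervalIntegrable_lemniscate (fun x hx ↦ Real.rpow_pos_of_pos ?_ _) one_pos)
  have := pow_lt_one₀ hx.1.le hx.2 (show 4 ≠ 0 by norm_num)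
  linarith

lemma continuousOn_arcsl : ContinuousOn arcsl (Set.Icc 0 1) := by
  have h := intervalIntegral.continuousOn_primitive_interval
    (a := (0 : ℝ)) (b := 1) (μ := volume) (f := fun y : ℝ ↦ (1 - y ^ 4) ^ (-(1:ℝ)/2))
    (by
      rw [Set.uIcc_of_le zero_le_one, integrableOn_Icc_iff_integrableOn_Ioc]
      exact (intervalIntegrable_iff_integrableOn_Ioc_of_le zero_le_one).mp
        intervalIntegrable_lemniscate)
  rwa [Set.uIcc_of_le zero_le_one] at h

lemma hasDerivAt_arcsl {x : ℝ} (hx : x ∈ Set.Ioo 0 1) :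
    HasDerivAt arcsl ((1 - x ^ 4) ^ (-(1:ℝ)/2)) x := by
  have h4 := pow_lt_one₀ hx.1.le hx.2 (show 4 ≠ 0 by norm_num)
  have hc : ContinuousAt (fun y : ℝ ↦ (1 - y ^ 4) ^ (-(1:ℝ)/2)) x :=
    ContinuousAt.rpow_const (by fun_prop) (Or.inl (by linarith))
  refine intervalIntegral.integral_hasDerivAt_right ?_ ?_ hc
  · refine intervalIntegrable_lemniscate.mono_set ?_
    rw [Set.uIcc_of_le hx.1.le, Set.uIcc_of_le zero_le_one]
    exact Set.Icc_subset_Icc_right hx.2.le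
  · exact ((by fun_prop : Measurable fun y : ℝ ↦ (1 - y ^ 4) ^ (-(1:ℝ)/2))
      |>.stronglyMeasurable.stronglyMeasurableAtFilter)

variable {t : ℝ} (ht : 0 < t)

lemma derivWeierstrassP_ofReal_sq {x : ℝ} (hx : x ∈ Set.Ioo 0 t) :
    ((sqPair t ht).derivWeierstrassP x).re ^ 2 = 4 * ((sqPair t ht).weierstrassP x).re ^ 3
      - 4 * ((sqPair t ht).weierstrassP (t / 2 : ℝ)).re ^ 2
        * ((sqPair t ht).weierstrassP x).re := by
  have h := derivWeierstrassP_sqPair_sq ht (ofReal_notMem_sqPair ht hx)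
  rw [g₂_sqPair, show (t / 2 : ℂ) = (t / 2 : ℝ) by push_cast; rfl, ← weierstrassP_ofReal ht x,
    ← weierstrassP_ofReal ht (t / 2), ← derivWeierstrassP_ofReal] at h
  exact_mod_cast h

lemma sqrt_weierstrassP_half_mul :
    √((sqPair t ht).weierstrassP (t / 2 : ℝ)).re * (t / 2) = arcsl 1 := by
  set e := ((sqPair t ht).weierstrassP (t / 2 : ℝ)).re with he
  set P : ℝ → ℝ := fun x ↦ ((sqPair t ht).weierstrassP x).re with hP
  have hthalf : t / 2 ∈ Set.Ioo 0 t := ⟨by linarith, by linarith⟩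
  have hsub : Set.Ioo 0 (t / 2) ⊆ Set.Ioo 0 t := Set.Ioo_subset_Ioo_right (by linarith)
  have he0 : 0 < e := weierstrassP_ofReal_pos ht hthalf
  have hPe : ∀ x ∈ Set.Ioo 0 (t / 2), e < P x := fun x hx ↦ weierstrassP_half_lt ht hx
  set y : ℝ → ℝ := fun x ↦ √(e / P x) with hy
  have hy01 : ∀ x ∈ Set.Ioo 0 (t / 2), y x ∈ Set.Ioo (0 : ℝ) 1 := by
    intro x hx
    have h1 := hPe x hx
    have h2 : 0 < P x := he0.trans h1
    refine ⟨Real.sqrt_pos.mpr (by positivity), ?_⟩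
    rw [hy, Real.sqrt_lt' one_pos, one_pow, div_lt_one h2]
    exact h1
  have hderiv : ∀ x ∈ Set.Ioo 0 (t / 2),
      HasDerivAt (fun x ↦ arcsl (y x) - √e * x) 0 x := by
    intro x hx
    have h1 := hPe x hx
    have h2 : 0 < P x := he0.trans h1
    have hd := hasDerivAt_weierstrassP_ofReal ht (hsub hx)
    have hneg := derivWeierstrassP_ofReal_neg ht hx
    have hsq := derivWeierstrassP_ofReal_sq ht (hsub hx)
    change HasDerivAt P _ x at hd
    change _ = 4 * (P x) ^ 3 - 4 * e ^ 2 * P x at hsq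
    set P' := ((sqPair t ht).derivWeierstrassP x).re
    have hy1 := hy01 x hx
    have hypos := hy1.1
    have hy2 : y x ^ 2 = e / P x := Real.sq_sqrt (by positivity)
    have h4 := pow_lt_one₀ hy1.1.le hy1.2 (show 4 ≠ 0 by norm_num)
    have hd1 : HasDerivAt y ((0 * P x - e * P') / P x ^ 2 / (2 * √(e / P x))) x :=
      ((hasDerivAt_const x e).div hd h2.ne').sqrt (div_pos he0 h2).ne'
    have hd2 := (hasDerivAt_arcsl hy1).comp x hd1
    have hd3 := hd2.sub ((hasDerivAt_id x).const_mul √e)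
    refine hd3.congr_deriv ?_
    rw [mul_one, sub_eq_zero]
    have hpos4 : 0 < 1 - y x ^ 4 := by linarith
    refine (Real.sqrt_eq_iff_mul_self_eq_of_pos ?_).mpr ?_ |>.symm
    · refine mul_pos (Real.rpow_pos_of_pos hpos4 _) ?_
      refine div_pos (div_pos ?_ (by positivity)) (by positivity)
      nlinarith
    · have hg : (1 - y x ^ 4) ^ (-(1:ℝ)/2) * (1 - y x ^ 4) ^ (-(1:ℝ)/2) = (1 - y x ^ 4)⁻¹ := by
        rw [← Real.rpow_add hpos4, ← Real.rpow_neg_one]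
        norm_num
      rw [mul_mul_mul_comm, hg]
      change _ * (_ / (2 * y x) * (_ / (2 * y x))) = e
      have hy4 : y x ^ 4 = e ^ 2 / P x ^ 2 := by
        rw [show y x ^ 4 = (y x ^ 2) ^ 2 by ring, hy2, div_pow]
      have : (0 * P x - e * P') / P x ^ 2 / (2 * y x) * ((0 * P x - e * P') / P x ^ 2 / (2 * y x))
          = e ^ 2 * P' ^ 2 / P x ^ 4 / (4 * y x ^ 2) := by
        field_simp
        ring
      rw [this, hy2, hsq, inv_mul_eq_iff_eq_mul₀ hpos4.ne', hy4]
      field_simp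
  obtain ⟨c, hc⟩ : ∃ c, ∀ x ∈ Set.Ioo 0 (t / 2), arcsl (y x) - √e * x = c := by
    have hne : t / 4 ∈ Set.Ioo 0 (t / 2) := ⟨by linarith, by linarith⟩
    exact ⟨_, fun x hx ↦ isOpen_Ioo.is_const_of_deriv_eq_zero isPreconnected_Ioo
      (fun z hz ↦ (hderiv z hz).differentiableAt.differentiableWithinAt)
      (fun z hz ↦ (hderiv z hz).deriv) hx hne⟩
  have hy0 : Tendsto y (𝓝[>] 0) (𝓝 0) := by
    have h1 : Tendsto (fun x : ℝ ↦ e * x ^ 2 / (x ^ 2 * P x)) (𝓝[>] 0) (𝓝 (0 / 1)) := by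
      refine Tendsto.div ?_ (tendsto_sq_mul_weierstrassP_ofReal ht) one_ne_zero
      have : Continuous fun x : ℝ ↦ e * x ^ 2 := by fun_prop
      simpa using (this.tendsto 0).mono_left nhdsWithin_le_nhds
    rw [zero_div] at h1
    have h2 := (Real.continuous_sqrt.tendsto 0).comp h1
    rw [Real.sqrt_zero] at h2
    refine h2.congr' ?_
    filter_upwards [self_mem_nhdsWithin] with x hx
    have : x ≠ 0 := ne_of_gt hx
    simp only [hy, Function.comp_apply]
    congr 1
    rw [mul_comm e, mul_div_mul_left _ _ (pow_ne_zero 2 this)]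
  have hy1 : Tendsto y (𝓝[<] (t / 2)) (𝓝 1) := by
    have h1 : ContinuousAt y (t / 2) := by
      have hPc : ContinuousAt P (t / 2) := (hasDerivAt_weierstrassP_ofReal ht hthalf).continuousAt
      exact (continuousAt_const.div hPc he0.ne').sqrt
    have h2 : y (t / 2) = 1 := by
      simp only [hy]
      rw [show P (t / 2) = e from rfl, div_self he0.ne', Real.sqrt_one]
    rw [← h2]
    exact h1.tendsto.mono_left nhdsWithin_le_nhds
  have lim0 : Tendsto (fun x ↦ arcsl (y x) - √e * x) (𝓝[>] 0) (𝓝 (arcsl 0 - √e * 0)) := by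
    refine Tendsto.sub ?_ ?_
    · refine (continuousOn_arcsl 0 (by simp)).tendsto.comp
        (tendsto_nhdsWithin_of_tendsto_nhds_of_eventually_within _ hy0 ?_)
      filter_upwards [Ioo_mem_nhdsGT hthalf.1] with x hx
      exact Set.Ioo_subset_Icc_self (hy01 x hx)
    · exact ((by fun_prop : Continuous fun x ↦ √e * x).tendsto 0).mono_left nhdsWithin_le_nhds
  have lim1 : Tendsto (fun x ↦ arcsl (y x) - √e * x) (𝓝[<] (t / 2))
      (𝓝 (arcsl 1 - √e * (t / 2))) := by
    refine Tendsto.sub ?_ ?_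
    · refine (continuousOn_arcsl 1 (by simp)).tendsto.comp
        (tendsto_nhdsWithin_of_tendsto_nhds_of_eventually_within _ hy1 ?_)
      filter_upwards [Ioo_mem_nhdsLT hthalf.1] with x hx
      exact Set.Ioo_subset_Icc_self (hy01 x hx)
    · exact ((by fun_prop : Continuous fun x ↦ √e * x).tendsto _).mono_left nhdsWithin_le_nhds
  have c0 : arcsl 0 - √e * 0 = c := tendsto_nhds_unique lim0
    (tendsto_const_nhds.congr' (by
      filter_upwards [Ioo_mem_nhdsGT hthalf.1] with x hx using (hc x hx).symm))
  have c1 : arcsl 1 - √e * (t / 2) = c := tendsto_nhds_unique lim1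
    (tendsto_const_nhds.congr' (by
      filter_upwards [Ioo_mem_nhdsLT hthalf.1] with x hx using (hc x hx).symm))
  have h00 : arcsl 0 = 0 := intervalIntegral.integral_same
  linarith

/-- The period pair `(ϖ, ϖi)`. -/
abbrev lemPair : PeriodPair := sqPair varpi varpi_pos

lemma weierstrassP_varpi_half : lemPair.weierstrassP (varpi / 2) = 1 := by
  have h := sqrt_weierstrassP_half_mul varpi_pos
  have hpos := varpi_pos
  rw [show arcsl 1 = 1 * (varpi / 2) by rw [varpi_eq]; ring] at h
  have h1 := mul_right_cancel₀ (by linarith : varpi / 2 ≠ 0) h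
  rw [Real.sqrt_eq_one] at h1
  rw [show (varpi / 2 : ℂ) = (varpi / 2 : ℝ) by push_cast; rfl, ← weierstrassP_ofReal, h1]
  norm_num

lemma derivWeierstrassP_lem_sq {z : ℂ} (hz : z ∉ lemPair.lattice) :
    lemPair.derivWeierstrassP z ^ 2 = 4 * lemPair.weierstrassP z ^ 3
      - 4 * lemPair.weierstrassP z := by
  rw [derivWeierstrassP_sqPair_sq _ hz, g₂_sqPair, weierstrassP_varpi_half]
  ring

end Lemniscate

section QuarterPeriod

open Filter Topology PeriodPair

lemma varpi_ne_zero : (varpi : ℂ) ≠ 0 := by exact_mod_cast varpi_pos.ne'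

lemma ω4_eq (m : ℤ × ℤ) : ω4 m = (lemPair.latticeEquivProd.symm m : ℂ) := by
  rw [latticeEquiv_symm_apply, ω4]
  simp only [sqPair]
  ring

lemma ω4_eq_zero_iff (m : ℤ × ℤ) : (lemPair.latticeEquivProd.symm m : ℂ) = 0 ↔ m = 0 := by
  rw [ZeroMemClass.coe_eq_zero, LinearEquiv.map_eq_zero_iff]

lemma wzeta4_eq (u : ℂ) : wzeta4 u = zetaW lemPair u := by
  simp only [wzeta4, zetaW, zetaExcept, one_div, ω4_eq]
  rw [← lemPair.latticeEquivProd.symm.toEquiv.tsum_eq]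
  congr 2 with m
  simp only [LinearEquiv.coe_toEquiv, ω4_eq_zero_iff, div_eq_mul_inv]

lemma wp4_eq (u : ℂ) : wp4 u = lemPair.weierstrassP u := by
  rw [weierstrassP_eq_add]
  simp only [wp4, weierstrassPExcept, one_div, ω4_eq]
  rw [← lemPair.latticeEquivProd.symm.toEquiv.tsum_eq]
  congr 2 with m
  simp only [LinearEquiv.coe_toEquiv, ω4_eq_zero_iff]

lemma wp4'_eq (u : ℂ) : wp4' u = lemPair.derivWeierstrassP u := by
  simp only [wp4', derivWeierstrassP, ω4_eq]
  rw [← lemPair.latticeEquivProd.symm.toEquiv.tsum_eq, ← tsum_neg]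
  congr 1 with m
  simp only [LinearEquiv.coe_toEquiv, div_eq_mul_inv, neg_mul]

lemma hasDerivAt_derivWeierstrassP_lem {z : ℂ} (hz : 2 * z ∉ lemPair.lattice) :
    HasDerivAt lemPair.derivWeierstrassP (6 * lemPair.weierstrassP z ^ 2 - 2) z := by
  have hz1 : z ∉ lemPair.lattice := fun h ↦ hz (by rw [two_mul]; exact add_mem h h)
  have h := lemPair.analyticOnNhd_weierstrassP.deriv z hz1
  rw [lemPair.deriv_weierstrassP] at h
  have hd := h.differentiableAt.hasDerivAt
  have hp := hasDerivAt_weierstrassP lemPair hz1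
  have h1 := hd.pow 2
  have h2 := ((hp.pow 3).const_mul 4).sub (hp.const_mul 4)
  have heq : (lemPair.derivWeierstrassP ^ 2) =ᶠ[𝓝 z]
      fun z ↦ 4 * lemPair.weierstrassP z ^ 3 - 4 * lemPair.weierstrassP z := by
    filter_upwards [lemPair.isClosed_lattice.isOpen_compl.mem_nhds hz1] with w hw
    exact derivWeierstrassP_lem_sq hw
  have h3 := (h2.congr_of_eventuallyEq heq).unique h1
  have hne := derivWeierstrassP_ne_zero lemPair hz
  refine hd.congr_deriv ?_
  apply mul_right_cancel₀ hne
  push_cast at h3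
  linear_combination -(1 / 2) * h3

/-- The quarter period `ϖ(1+i)/4`. -/
abbrev quarterPt : ℂ := varpi * ((1 + I) / 4)

lemma diag_notMem {x : ℝ} (hx : x ∈ Set.Ioo 0 varpi) : (x * (1 + I) : ℂ) ∉ lemPair.lattice :=
  notMem_sqPair_of_re varpi_pos (by simpa using hx.1) (by simpa using hx.2)

lemma two_mul_diag_notMem {x : ℝ} (hx : x ∈ Set.Ioo 0 (varpi / 2)) :
    2 * (x * (1 + I) : ℂ) ∉ lemPair.lattice := by
  rw [← mul_assoc, show (2 * x : ℂ) = (2 * x : ℝ) by push_cast; rfl]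
  exact diag_notMem ⟨by linarith [hx.1], by linarith [hx.2]⟩

lemma quarterPt_eq : quarterPt = (varpi / 4 : ℝ) * (1 + I) := by
  push_cast; ring

lemma weierstrassP_quarterPt_sq : lemPair.weierstrassP quarterPt ^ 2 = -1 := by
  have hpos := varpi_pos
  have h2u : 2 * quarterPt ∉ lemPair.lattice := by
    rw [quarterPt_eq]
    exact two_mul_diag_notMem ⟨by linarith, by linarith⟩
  have hu : quarterPt ∉ lemPair.lattice := fun h ↦ h2u (by rw [two_mul]; exact add_mem h h)
  have h3u : quarterPt + 2 * quarterPt ∉ lemPair.lattice := by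
    rw [quarterPt_eq, show ((varpi / 4 : ℝ) * (1 + I) + 2 * ((varpi / 4 : ℝ) * (1 + I)) : ℂ)
      = (3 * varpi / 4 : ℝ) * (1 + I) by push_cast; ring]
    exact diag_notMem ⟨by linarith, by linarith⟩
  have hmu : quarterPt - 2 * quarterPt ∉ lemPair.lattice := by
    rw [show quarterPt - 2 * quarterPt = -quarterPt by ring, neg_mem_iff]
    exact hu
  have h4u : 4 * quarterPt ∈ lemPair.lattice := by
    rw [mem_sqPair]
    refine ⟨1, 1, ?_⟩
    simp only [quarterPt]
    push_cast
    ring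
  have hw0 : lemPair.weierstrassP (2 * quarterPt) = 0 := by
    rw [← weierstrassP_diag_half varpi_pos]
    congr 1
    simp only [quarterPt]
    ring
  have hne : lemPair.weierstrassP quarterPt ≠ 0 := by
    rw [← hw0]
    refine weierstrassP_ne _ hu h2u h3u hmu
  set A := lemPair.weierstrassP quarterPt with hA
  set A' := lemPair.derivWeierstrassP quarterPt with hA'
  set S : ℂ → ℂ := fun u ↦ zetaW lemPair (u + 2 * quarterPt) + zetaW lemPair (u - 2 * quarterPt)
    - 2 * zetaW lemPair u with hS
  have hSP : S quarterPt * A = A' := by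
    have := zetaW_add_add_zetaW_sub lemPair h2u h2u h3u hmu
    rwa [hw0, sub_zero] at this
  have d1 : HasDerivAt S 0 quarterPt := by
    have e1 := (hasDerivAt_zetaW lemPair h3u).comp_add_const quarterPt (2 * quarterPt)
    have e2 := (hasDerivAt_zetaW lemPair hmu).comp_sub_const quarterPt (2 * quarterPt)
    refine ((e1.add e2).sub ((hasDerivAt_zetaW lemPair hu).const_mul 2)).congr_deriv ?_
    rw [show quarterPt + 2 * quarterPt = -quarterPt + 4 * quarterPt by ring,
      weierstrassP_add _ h4u, show quarterPt - 2 * quarterPt = -quarterPt by ring,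
      lemPair.weierstrassP_neg]
    ring
  have d2 := d1.mul (hasDerivAt_weierstrassP lemPair hu)
  have d3 := hasDerivAt_derivWeierstrassP_lem h2u
  have heq : lemPair.derivWeierstrassP =ᶠ[𝓝 quarterPt] S * lemPair.weierstrassP := by
    have hopen := lemPair.isClosed_lattice.isOpen_compl
    have c1 : ∀ᶠ u in 𝓝 quarterPt, 2 * u ∉ lemPair.lattice :=
      (by fun_prop : ContinuousAt (fun u : ℂ ↦ 2 * u) quarterPt).eventually (hopen.mem_nhds h2u)
    have c2 : ∀ᶠ u in 𝓝 quarterPt, u + 2 * quarterPt ∉ lemPair.lattice :=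
      (by fun_prop : ContinuousAt (fun u : ℂ ↦ u + 2 * quarterPt) quarterPt).eventually
        (hopen.mem_nhds h3u)
    have c3 : ∀ᶠ u in 𝓝 quarterPt, u - 2 * quarterPt ∉ lemPair.lattice :=
      (by fun_prop : ContinuousAt (fun u : ℂ ↦ u - 2 * quarterPt) quarterPt).eventually
        (hopen.mem_nhds hmu)
    filter_upwards [c1, c2, c3] with u h1 h2 h3
    have := zetaW_add_add_zetaW_sub lemPair h1 h2u h2 h3
    rw [hw0, sub_zero] at this
    exact this.symm
  have h4 := (d2.congr_of_eventuallyEq heq).unique d3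
  have hsq := derivWeierstrassP_lem_sq hu
  rw [← hA] at *
  rw [← hA'] at *
  have : A * (A ^ 2 + 1) = 0 := by
    linear_combination (1 / 2) * hsq - (1 / 2) * A * h4 + (1 / 2) * A' * hSP
  exact eq_neg_of_add_eq_zero_left ((mul_eq_zero.mp this).resolve_left hne)

lemma conj_diag (x : ℝ) : (starRingEnd ℂ) (x * (1 + I) : ℂ) = -(I * (x * (1 + I))) := by
  simp only [map_mul, map_add, map_one, conj_ofReal, conj_I]
  linear_combination (x : ℂ) * I_sq

lemma weierstrassP_diag_re (x : ℝ) : (lemPair.weierstrassP (x * (1 + I))).re = 0 := by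
  have h := weierstrassP_conj varpi_pos (x * (1 + I))
  rw [conj_diag, weierstrassP_neg, weierstrassP_I_mul] at h
  have := congrArg re h
  simp only [neg_re, conj_re] at this
  linarith

lemma derivWeierstrassP_diag_re_im (x : ℝ) :
    (lemPair.derivWeierstrassP (x * (1 + I))).im
      = (lemPair.derivWeierstrassP (x * (1 + I))).re := by
  have h := derivWeierstrassP_conj varpi_pos (x * (1 + I))
  rw [conj_diag, derivWeierstrassP_neg, derivWeierstrassP_I_mul] at h
  have := congrArg re h
  simpa using this

lemma weierstrassP_quarterPt : lemPair.weierstrassP quarterPt = -I := by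
  have hpos := varpi_pos
  have hcont : ContinuousOn (fun x : ℝ ↦ -(lemPair.weierstrassP (x * (1 + I))).im)
      (Set.Ioo 0 (varpi / 2)) := by
    intro x hx
    have h := (hasDerivAt_weierstrassP lemPair
      (diag_notMem (x := x) ⟨hx.1, by linarith [hx.2]⟩)).continuousAt
    have h2 : ContinuousAt (fun x : ℝ ↦ (x * (1 + I) : ℂ)) x := by fun_prop
    have h3 := ContinuousAt.comp (f := fun x : ℝ ↦ (x * (1 + I) : ℂ)) h h2
    exact (continuous_im.continuousAt.comp h3).neg.continuousWithinAt
  have him : (lemPair.weierstrassP quarterPt).im < 0 := by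
    rw [quarterPt_eq, ← neg_pos]
    refine pos_of_ne_zero_of_tendsto (n := 2) (c := 1 / 2) (b := varpi / 2) one_half_pos
      (g := fun x : ℝ ↦ -(lemPair.weierstrassP (x * (1 + I))).im) hcont ?_ ?_
      ⟨by linarith, by linarith⟩
    · intro x hx h
      refine weierstrassP_ne_zero_of_im varpi_pos (z := x * (1 + I)) ?_ ?_
        (diag_notMem ⟨hx.1, by linarith [hx.2]⟩)
        (Complex.ext (weierstrassP_diag_re x) (neg_eq_zero.mp h))
      · simpa using by linarith [hx.1]
      · simpa using hx.2
    · have hne : (1 + I) ≠ 0 := fun h ↦ by simpa using congrArg re h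
      have h := (tendsto_sq_mul_weierstrassP lemPair).comp (tendsto_ofReal_mul_nhdsNE hne)
      have h' := ((continuous_re.tendsto _).comp h).const_mul (1 / 2)
      rw [one_re, mul_one] at h'
      refine h'.congr fun x ↦ ?_
      simp only [Function.comp_apply]
      rw [show ((x : ℂ) * (1 + I)) ^ 2 = (2 * x ^ 2 : ℝ) * I by
        push_cast; linear_combination (x : ℂ) ^ 2 * I_sq]
      rw [mul_assoc, re_ofReal_mul, I_mul_re]
      ring
  have hsq := weierstrassP_quarterPt_sq
  have : (lemPair.weierstrassP quarterPt - I) * (lemPair.weierstrassP quarterPt + I) = 0 := by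
    linear_combination hsq - I_sq
  rcases mul_eq_zero.mp this with h | h
  · rw [sub_eq_zero.mp h] at him
    norm_num at him
  · exact eq_neg_of_add_eq_zero_left h

lemma derivWeierstrassP_quarterPt : lemPair.derivWeierstrassP quarterPt = 2 + 2 * I := by
  have hpos := varpi_pos
  have hcont : ContinuousOn (fun x : ℝ ↦ (lemPair.derivWeierstrassP (x * (1 + I))).re)
      (Set.Ioo 0 (varpi / 2)) := by
    intro x hx
    have h := continuousAt_derivWeierstrassP (diag_notMem (x := x) ⟨hx.1, by linarith [hx.2]⟩)
    have h2 : ContinuousAt (fun x : ℝ ↦ (x * (1 + I) : ℂ)) x := by fun_prop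
    have h3 := ContinuousAt.comp (f := fun x : ℝ ↦ (x * (1 + I) : ℂ)) h h2
    exact (continuous_re.continuousAt.comp h3).continuousWithinAt
  have hre : 0 < (lemPair.derivWeierstrassP quarterPt).re := by
    rw [quarterPt_eq]
    refine pos_of_ne_zero_of_tendsto (n := 3) (c := 1 / 2) (b := varpi / 2) one_half_pos
      (g := fun x : ℝ ↦ (lemPair.derivWeierstrassP (x * (1 + I))).re) hcont ?_ ?_
      ⟨by linarith, by linarith⟩
    · intro x hx h
      refine derivWeierstrassP_ne_zero lemPair (v := x * (1 + I)) (two_mul_diag_notMem hx)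
        (Complex.ext h ?_)
      rw [derivWeierstrassP_diag_re_im]
      exact h
    · have hne : (1 + I) ≠ 0 := fun h ↦ by simpa using congrArg re h
      have h := (tendsto_cube_mul_derivWeierstrassP lemPair).comp (tendsto_ofReal_mul_nhdsNE hne)
      have h' := ((continuous_re.tendsto _).comp h).const_mul (-1 / 4)
      rw [show -1 / 4 * (-2 : ℂ).re = 1 / 2 by norm_num] at h'
      refine h'.congr fun x ↦ ?_
      simp only [Function.comp_apply]
      rw [show ((x : ℂ) * (1 + I)) ^ 3 = (2 * x ^ 3 : ℝ) * (-1 + I) by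
        push_cast; linear_combination (x : ℂ) ^ 3 * (I + 3) * I_sq]
      rw [mul_assoc, re_ofReal_mul, mul_re, derivWeierstrassP_diag_re_im]
      simp
      ring
  have h2u : quarterPt ∉ lemPair.lattice := by
    rw [quarterPt_eq]
    exact diag_notMem ⟨by linarith, by linarith⟩
  have hsq := derivWeierstrassP_lem_sq h2u
  rw [weierstrassP_quarterPt] at hsq
  have : (lemPair.derivWeierstrassP quarterPt - (2 + 2 * I)) *
      (lemPair.derivWeierstrassP quarterPt + (2 + 2 * I)) = 0 := by
    linear_combination hsq - 4 * (I + 1) * I_sq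
  rcases mul_eq_zero.mp this with h | h
  · exact sub_eq_zero.mp h
  · rw [eq_neg_of_add_eq_zero_left h] at hre
    norm_num at hre

end QuarterPeriod

section DivisionValues

open PeriodPair

lemma four_varpi_mul_notMem {z : ℂ} (hz : ∀ m n : ℤ, 4 * z ≠ m + n * I) :
    4 * (varpi * z) ∉ lemPair.lattice := by
  rw [mul_left_comm, mul_mem_sqPair varpi_pos]
  rintro ⟨m, n, h⟩
  exact hz m n h

lemma notMem_of_four_mul {L : PeriodPair} {u : ℂ} (hu : 4 * u ∉ L.lattice) : u ∉ L.lattice :=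
  fun h ↦ hu (by simpa using L.lattice.smul_mem (4 : ℤ) h)

lemma two_mul_notMem_of_four_mul {L : PeriodPair} {u : ℂ} (hu : 4 * u ∉ L.lattice) :
    2 * u ∉ L.lattice :=
  fun h ↦ hu (by
    rw [show 4 * u = 2 * u + 2 * u by ring]
    exact add_mem h h)

lemma add_notMem_of_four_mul {L : PeriodPair} {u v : ℂ} (hu : 4 * u ∉ L.lattice)
    (hv : 4 * v ∈ L.lattice) : u + v ∉ L.lattice := by
  refine notMem_of_four_mul fun h ↦ hu ?_
  rw [mul_add] at h
  simpa using sub_mem h hv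

lemma sub_notMem_of_four_mul {L : PeriodPair} {u v : ℂ} (hu : 4 * u ∉ L.lattice)
    (hv : 4 * v ∈ L.lattice) : u - v ∉ L.lattice := by
  refine notMem_of_four_mul fun h ↦ hu ?_
  rw [mul_sub] at h
  simpa using add_mem h hv

lemma weierstrassP_ne_of_four_mul {L : PeriodPair} {u v : ℂ} (hu : 4 * u ∉ L.lattice)
    (hv : v ∉ L.lattice) (hv4 : 4 * v ∈ L.lattice) : L.weierstrassP u ≠ L.weierstrassP v :=
  weierstrassP_ne L (notMem_of_four_mul hu) hv (add_notMem_of_four_mul hu hv4)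
    (sub_notMem_of_four_mul hu hv4)

lemma zetaW_add_half {L : PeriodPair} {v : ℂ} (hv : v ∉ L.lattice) (hv2 : 2 * v ∈ L.lattice) :
    ∃ c, ∀ u, 4 * u ∉ L.lattice → zetaW L (u + v) = zetaW L u
      + L.derivWeierstrassP u / (2 * (L.weierstrassP u - L.weierstrassP v)) + c := by
  obtain ⟨η, hη⟩ := exists_quasiperiod L hv2
  refine ⟨η / 2, fun u hu ↦ ?_⟩
  have hv4 : 4 * v ∈ L.lattice := by
    rw [show 4 * v = 2 * v + 2 * v by ring]
    exact add_mem hv2 hv2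
  have h1 := zetaW_add_add_zetaW_sub L (two_mul_notMem_of_four_mul hu) hv
    (add_notMem_of_four_mul hu hv4) (sub_notMem_of_four_mul hu hv4)
  have h2 := hη (u - v) (sub_notMem_of_four_mul hu hv4)
  rw [show u - v + 2 * v = u + v by ring] at h2
  have hne := sub_ne_zero.mpr (weierstrassP_ne_of_four_mul hu hv hv4)
  have h3 : L.derivWeierstrassP u / (2 * (L.weierstrassP u - L.weierstrassP v))
      = (zetaW L (u + v) + zetaW L (u - v) - 2 * zetaW L u) / 2 := by
    rw [div_eq_div_iff (by simpa using hne) two_ne_zero]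
    linear_combination (-2) * h1
  linear_combination (1 / 2) * h2 - h3

lemma zetaW_add_sub {L : PeriodPair} {u v : ℂ} (hu : 4 * u ∉ L.lattice)
    (hv : 2 * v ∉ L.lattice) (hv4 : 4 * v ∈ L.lattice) :
    zetaW L (u + v) - zetaW L (u - v)
      = 2 * zetaW L v - L.derivWeierstrassP v / (L.weierstrassP u - L.weierstrassP v) := by
  have h1 := zetaW_add_sub_zetaW_sub L hv (notMem_of_four_mul hu)
    (add_notMem_of_four_mul hu hv4) (sub_notMem_of_four_mul hu hv4)
  have hv1 : v ∉ L.lattice := fun h ↦ hv (by rw [two_mul]; exact add_mem h h)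
  have hne := sub_ne_zero.mpr (weierstrassP_ne_of_four_mul hu hv1 hv4)
  field_simp
  linear_combination h1

lemma Z4_sub_half : ∃ c : ℂ, ∀ z : ℂ, (∀ m n : ℤ, 4 * z ≠ m + n * I) →
    Z4 (z + 1 / 2) - Z4 (z + I / 2) = c - (1 + I) * phi4 z := by
  have hpos := varpi_pos
  have hv1 : (varpi * (1 / 2) : ℂ) ∉ lemPair.lattice :=
    notMem_sqPair_of_re hpos (by simpa using hpos) (by simp; linarith)
  have hv2 : (varpi * (I / 2) : ℂ) ∉ lemPair.lattice :=
    notMem_sqPair_of_im hpos (by simpa using hpos) (by simp; linarith)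
  have hm1 : 2 * (varpi * (1 / 2) : ℂ) ∈ lemPair.lattice := by
    rw [show 2 * (varpi * (1 / 2) : ℂ) = varpi by ring]
    exact ofReal_mem_sqPair hpos
  have hm2 : 2 * (varpi * (I / 2) : ℂ) ∈ lemPair.lattice := by
    rw [show 2 * (varpi * (I / 2) : ℂ) = varpi * I by ring]
    exact ofReal_mul_I_mem_sqPair hpos
  obtain ⟨c₁, h1⟩ := zetaW_add_half hv1 hm1
  obtain ⟨c₂, h2⟩ := zetaW_add_half hv2 hm2
  refine ⟨c₁ - c₂ - (Real.pi / varpi : ℝ) * (starRingEnd ℂ) (1 / 2 - I / 2), fun z hz ↦ ?_⟩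
  have hu := four_varpi_mul_notMem hz
  have e1 : lemPair.weierstrassP (varpi * (1 / 2)) = 1 := by
    rw [mul_one_div, weierstrassP_varpi_half]
  have e2 : lemPair.weierstrassP (varpi * (I / 2)) = -1 := by
    rw [weierstrassP_I_half, weierstrassP_varpi_half]
  have hd1 : 4 * (varpi * (1 / 2) : ℂ) ∈ lemPair.lattice := by
    rw [show 4 * (varpi * (1 / 2) : ℂ) = 2 * (varpi * (1 / 2)) + 2 * (varpi * (1 / 2)) by ring]
    exact add_mem hm1 hm1
  have hd2 : 4 * (varpi * (I / 2) : ℂ) ∈ lemPair.lattice := by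
    rw [show 4 * (varpi * (I / 2) : ℂ) = 2 * (varpi * (I / 2)) + 2 * (varpi * (I / 2)) by ring]
    exact add_mem hm2 hm2
  have n1 := weierstrassP_ne_of_four_mul hu hv1 hd1
  have n2 := weierstrassP_ne_of_four_mul hu hv2 hd2
  have n3 := derivWeierstrassP_ne_zero _ (two_mul_notMem_of_four_mul hu)
  have hsq := derivWeierstrassP_lem_sq (notMem_of_four_mul hu)
  have h1' := h1 _ hu
  have h2' := h2 _ hu
  rw [e1] at n1 h1'
  rw [e2] at n2 h2'
  simp only [Z4, phi4, wzeta4_eq, wp4_eq, wp4'_eq, mul_add, h1', h2', map_add, map_sub]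
  set P := lemPair.weierstrassP (varpi * z)
  set P' := lemPair.derivWeierstrassP (varpi * z)
  have n1' := sub_ne_zero.mpr n1
  have n2' := sub_ne_zero.mpr n2
  have key : P' / (2 * (P - 1)) - P' / (2 * (P - -1)) = 4 * P / P' := by
    field_simp
    linear_combination 2 * hsq
  have key2 : (1 + I) * (-2 * (1 - I) * P / P') = - (4 * P / P') := by
    rw [← neg_div, ← mul_div_assoc]
    congr 1
    linear_combination 2 * P * I_sq
  linear_combination key + key2

lemma quarterPt_mem : 4 * quarterPt ∈ lemPair.lattice := by
  rw [mem_sqPair]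
  refine ⟨1, 1, ?_⟩
  simp only [quarterPt]
  push_cast
  ring

lemma two_mul_quarterPt_notMem : 2 * quarterPt ∉ lemPair.lattice := by
  have hpos := varpi_pos
  rw [quarterPt_eq]
  exact two_mul_diag_notMem ⟨by linarith, by linarith⟩

/-- `Z(u + a) - Z(u - a)` and its rotation by `i`, for the quarter period `a = (1 + i) / 4`. -/
lemma Z4_quarter : ∃ c₁ c₂ : ℂ, ∀ z : ℂ, (∀ m n : ℤ, 4 * z ≠ m + n * I) →
    wp4 (varpi * z) + I ≠ 0 ∧ wp4 (varpi * z) - I ≠ 0 ∧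
    Z4 (z + (1 + I) / 4) - Z4 (z - (1 + I) / 4) =
      c₁ - (2 + 2 * I) / (wp4 (varpi * z) + I) ∧
    Z4 (z + I * ((1 + I) / 4)) - Z4 (z - I * ((1 + I) / 4)) =
      c₂ - I * (2 + 2 * I) / (wp4 (varpi * z) - I) := by
  refine ⟨2 * zetaW lemPair quarterPt
      - (Real.pi / varpi : ℝ) * (starRingEnd ℂ) (2 * ((1 + I) / 4)),
    2 * zetaW lemPair (I * quarterPt)
      - (Real.pi / varpi : ℝ) * (starRingEnd ℂ) (2 * (I * ((1 + I) / 4))), fun z hz ↦ ?_⟩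
  have hu := four_varpi_mul_notMem hz
  have r2 : 2 * (I * quarterPt) ∉ lemPair.lattice := by
    rw [mul_left_comm, I_mul_mem_sqPair]
    exact two_mul_quarterPt_notMem
  have r4 : 4 * (I * quarterPt) ∈ lemPair.lattice := by
    rw [mul_left_comm, I_mul_mem_sqPair]
    exact quarterPt_mem
  have r1 : I * quarterPt ∉ lemPair.lattice := fun h ↦ r2 (by rw [two_mul]; exact add_mem h h)
  have s1 : quarterPt ∉ lemPair.lattice :=
    fun h ↦ two_mul_quarterPt_notMem (by rw [two_mul]; exact add_mem h h)
  have n1 := sub_ne_zero.mpr (weierstrassP_ne_of_four_mul hu s1 quarterPt_mem)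
  have n2 := sub_ne_zero.mpr (weierstrassP_ne_of_four_mul hu r1 r4)
  have h1 := zetaW_add_sub hu two_mul_quarterPt_notMem quarterPt_mem
  have h2 := zetaW_add_sub hu r2 r4
  rw [weierstrassP_I_mul, weierstrassP_quarterPt, neg_neg] at n2
  rw [weierstrassP_I_mul, weierstrassP_quarterPt, derivWeierstrassP_I_mul,
    derivWeierstrassP_quarterPt, neg_neg] at h2
  rw [weierstrassP_quarterPt, sub_neg_eq_add] at n1
  rw [weierstrassP_quarterPt, derivWeierstrassP_quarterPt, sub_neg_eq_add] at h1
  simp only [Z4, wzeta4_eq, wp4_eq, map_sub, map_add, map_mul] at *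
  refine ⟨n1, n2, ?_, ?_⟩
  · rw [mul_add, mul_sub]
    simp only [map_ofNat]
    linear_combination h1
  · rw [mul_add, mul_sub, show (varpi : ℂ) * (I * ((1 + I) / 4)) = I * quarterPt by
      simp only [quarterPt]; ring]
    simp only [map_ofNat]
    linear_combination h2

lemma wp4_I_mul (z : ℂ) : wp4 (varpi * (I * z)) = - wp4 (varpi * z) := by
  rw [wp4_eq, wp4_eq, mul_left_comm, weierstrassP_I_mul]

lemma Z4_quartic_sum : ∃ c : ℂ, ∀ z : ℂ, (∀ m n : ℤ, 4 * z ≠ m + n * I) →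
    Z4 (z - (1 + I) / 4) - Z4 (z + (1 + I) / 4)
      + I * Z4 (z - I * ((1 + I) / 4)) - I * Z4 (z + I * ((1 + I) / 4))
      = c - (1 - I) * (psi4 z + psi4 (I * z)) := by
  obtain ⟨c₁, c₂, h⟩ := Z4_quarter
  refine ⟨-c₁ - I * c₂ + 2 * (1 - I), fun z hz ↦ ?_⟩
  obtain ⟨n1, n2, h1, h2⟩ := h z hz
  simp only [psi4, wp4_I_mul]
  have n3 : -wp4 (varpi * z) - I ≠ 0 := fun h ↦ n1 (by linear_combination -h)
  set P := wp4 (varpi * z)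
  have key : (2 + 2 * I) / (P + I) + I * (I * (2 + 2 * I) / (P - I))
      = 2 * (1 - I) - (1 - I) * ((P + I) / (P - I) + (-P + I) / (-P - I)) := by
    rw [show (-P + I) / (-P - I) = (P - I) / (P + I) by
      rw [← neg_div_neg_eq]; congr 1 <;> ring]
    field_simp
    ring_nf
    simp only [I_sq, I_pow_three, I_pow_four]
    ring
  linear_combination -h1 - I * h2 + key

lemma Z4_conj_quartic_sum : ∃ c : ℂ, ∀ z : ℂ, (∀ m n : ℤ, 4 * z ≠ m + n * I) →
    Z4 (z - (1 + I) / 4) - Z4 (z + (1 + I) / 4)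
      - I * Z4 (z - I * ((1 + I) / 4)) + I * Z4 (z + I * ((1 + I) / 4))
      = c + (1 - I) * (psi4 z - psi4 (I * z)) := by
  obtain ⟨c₁, c₂, h⟩ := Z4_quarter
  refine ⟨-c₁ + I * c₂, fun z hz ↦ ?_⟩
  obtain ⟨n1, n2, h1, h2⟩ := h z hz
  simp only [psi4, wp4_I_mul]
  have n3 : -wp4 (varpi * z) - I ≠ 0 := fun h ↦ n1 (by linear_combination -h)
  set P := wp4 (varpi * z)
  have key : (2 + 2 * I) / (P + I) - I * (I * (2 + 2 * I) / (P - I))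
      = (1 - I) * ((P + I) / (P - I) - (-P + I) / (-P - I)) := by
    rw [show (-P + I) / (-P - I) = (P - I) / (P + I) by
      rw [← neg_div_neg_eq]; congr 1 <;> ring]
    field_simp
    ring_nf
    simp only [I_sq, I_pow_three, I_pow_four]
    ring
  linear_combination -h1 + I * h2 + key

end DivisionValues

section GaussianLattice

open PeriodPair

lemma mem_O4 {z : ℂ} : z ∈ O4 ↔ ∃ m n : ℤ, z = m + n * I := by
  constructor
  · intro hz
    induction hz using Subring.closure_induction with
    | mem x hx => exact ⟨0, 1, by simpa using hx⟩
    | zero => exact ⟨0, 0, by simp⟩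
    | one => exact ⟨1, 0, by simp⟩
    | add x y _ _ hx hy =>
      obtain ⟨a, b, rfl⟩ := hx
      obtain ⟨c, d, rfl⟩ := hy
      exact ⟨a + c, b + d, by push_cast; ring⟩
    | neg x _ hx =>
      obtain ⟨a, b, rfl⟩ := hx
      exact ⟨-a, -b, by push_cast; ring⟩
    | mul x y _ _ hx hy =>
      obtain ⟨a, b, rfl⟩ := hx
      obtain ⟨c, d, rfl⟩ := hy
      exact ⟨a * c - b * d, a * d + b * c, by push_cast; linear_combination b * d * I_sq⟩
  · rintro ⟨m, n, rfl⟩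
    exact add_mem (intCast_mem _ m) (mul_mem (intCast_mem _ n) (Subring.subset_closure rfl))

lemma I_mem_O4 : I ∈ O4 := Subring.subset_closure rfl

/-- The parametrization of `ℤ[i]` by coordinates. -/
def gaussEquiv : ℤ × ℤ ≃ O4 :=
  Equiv.ofBijective (fun m ↦ ⟨m.1 + m.2 * I, mem_O4.mpr ⟨_, _, rfl⟩⟩) <| by
    constructor
    · intro m n h
      have h := Subtype.ext_iff.mp h
      have h1 := congrArg re h
      have h2 := congrArg im h
      simp at h1 h2
      exact Prod.ext h1 h2
    · rintro ⟨z, hz⟩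
      obtain ⟨m, n, rfl⟩ := mem_O4.mp hz
      exact ⟨(m, n), rfl⟩

lemma gaussEquiv_apply (m : ℤ × ℤ) : (gaussEquiv m : ℂ) = m.1 + m.2 * I := rfl

lemma mem_O4_iff_mem_sqPair {z : ℂ} : z ∈ O4 ↔ z ∈ (sqPair 1 one_pos).lattice := by
  rw [mem_O4, mem_sqPair]
  simp

lemma summable_norm_add_rpow_O4 {r : ℝ} (hr : r < -2) (z : ℂ) :
    Summable fun w : O4 ↦ ‖z + w‖ ^ r := by
  have h := ZLattice.summable_norm_sub_rpow (L := (sqPair 1 one_pos).lattice) r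
    (by simpa using hr) (-z)
  rw [← ((Equiv.refl ℂ).subtypeEquiv fun _ ↦ mem_O4_iff_mem_sqPair :
    O4 ≃ (sqPair 1 one_pos).lattice).summable_iff] at h
  refine h.congr fun w ↦ ?_
  rw [add_comm z, ← sub_neg_eq_add]
  rfl

lemma summable_norm_rpow_O4 {r : ℝ} (hr : r < -2) : Summable fun w : O4 ↦ ‖(w : ℂ)‖ ^ r := by
  simpa using summable_norm_add_rpow_O4 hr 0

lemma finite_norm_le_O4 (B : ℝ) : {w : O4 | ‖(w : ℂ)‖ ≤ B}.Finite := by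
  have h := (summable_norm_rpow_O4 (r := -3) (by norm_num)).tendsto_cofinite_zero
  rcases le_or_gt B 0 with hB | hB
  · refine (Set.finite_singleton (0 : O4)).subset fun w hw ↦ ?_
    have : ‖(w : ℂ)‖ ≤ 0 := le_trans hw hB
    simpa using this
  · have h1 := h.eventually (gt_mem_nhds (Real.rpow_pos_of_pos hB (-3)))
    rw [Filter.eventually_cofinite] at h1
    refine (h1.union (Set.finite_singleton (0 : O4))).subset fun w hw ↦ ?_
    by_cases h0 : w = 0
    · exact Or.inr h0
    · refine Or.inl (not_lt.mpr ?_)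
      exact Real.rpow_le_rpow_of_nonpos (by simpa using h0) hw (by norm_num)

/-- The term `ū |u|^{-2s}` of the Hecke series. -/
def heckeTerm (s u : ℂ) : ℂ := (starRingEnd ℂ) u * (normSq u : ℂ) ^ (-s)

@[simp] lemma heckeTerm_zero (s : ℂ) : heckeTerm s 0 = 0 := by simp [heckeTerm]

lemma heckeTerm_mul (s u v : ℂ) : heckeTerm s (u * v) = heckeTerm s u * heckeTerm s v := by
  simp only [heckeTerm, map_mul, ofReal_mul, mul_cpow_ofReal_nonneg (normSq_nonneg u)
    (normSq_nonneg v)]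
  ring

lemma heckeTerm_one_left (u : ℂ) : heckeTerm 1 u = u⁻¹ := by
  rw [heckeTerm, cpow_neg_one, inv_def u, ofReal_inv]

lemma heckeTerm_neg (s u : ℂ) : heckeTerm s (-u) = -heckeTerm s u := by
  simp [heckeTerm]

lemma heckeTerm_I_mul (s u : ℂ) : heckeTerm s (I * u) = -I * heckeTerm s u := by
  simp [heckeTerm, mul_assoc]

lemma norm_heckeTerm_le (s u : ℂ) : ‖heckeTerm s u‖ ≤ ‖u‖ ^ (1 - 2 * s.re) := by
  rcases eq_or_ne u 0 with rfl | hu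
  · simp only [heckeTerm_zero, norm_zero]
    positivity
  · have hu' := norm_pos_iff.mpr hu
    rw [heckeTerm, norm_mul, norm_cpow_eq_rpow_re_of_pos (normSq_pos.mpr hu), normSq_eq_norm_sq,
      norm_conj, ← Real.rpow_natCast, ← Real.rpow_mul hu'.le, Real.rpow_sub hu', Real.rpow_one,
      div_eq_mul_inv, ← Real.rpow_neg hu'.le]
    simp

lemma differentiable_heckeTerm (u : ℂ) : Differentiable ℂ fun s ↦ heckeTerm s u := by
  rcases eq_or_ne u 0 with rfl | hu
  · simp
  · simp only [heckeTerm]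
    have : (normSq u : ℂ) ≠ 0 := by simpa using hu
    exact fun s ↦ (differentiableAt_const _).mul
      ((differentiableAt_id.neg).const_cpow (Or.inl this))

lemma norm_heckeTerm_expansion_le {ε s : ℂ} (hε : ‖ε‖ ≤ 1 / 2) :
    ‖heckeTerm s (1 + ε) - 1 + s * ε - (1 - s) * (starRingEnd ℂ) ε‖
      ≤ (14 * ‖s‖ ^ 2 * Real.exp (2 * ‖s‖) + 5 * ‖s‖) * ‖ε‖ ^ 2 := by
  have h1 : 1 + ε ≠ 0 := by
    intro h
    have : ε = -1 := by linear_combination h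
    rw [this] at hε
    norm_num at hε
  set l : ℝ := (log (1 + ε)).re with hl
  have hterm : heckeTerm s (1 + ε) = (1 + (starRingEnd ℂ) ε) * exp (-(2 * s * l)) := by
    have hn : (normSq (1 + ε) : ℂ) ≠ 0 := by simpa using h1
    rw [heckeTerm, map_add, map_one, cpow_def_of_ne_zero hn, ← ofReal_log (normSq_nonneg _), hl,
      log_re, normSq_eq_norm_sq, Real.log_pow]
    push_cast
    ring_nf
  have hlog : ‖log (1 + ε) - ε‖ ≤ ‖ε‖ ^ 2 := by
    refine (norm_log_one_add_sub_self_le (by linarith)).trans ?_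
    have : (1 - ‖ε‖)⁻¹ ≤ 2 := by
      rw [inv_le_comm₀ (by linarith) two_pos]
      linarith
    nlinarith [sq_nonneg ‖ε‖]
  have hdl : |l - ε.re| ≤ ‖ε‖ ^ 2 := by
    rw [hl, ← sub_re]
    exact (abs_re_le_norm _).trans hlog
  have hle : |l| ≤ 3 / 2 * ‖ε‖ := by
    have h2 := abs_re_le_norm ε
    have h3 := abs_sub_abs_le_abs_sub l ε.re
    nlinarith [norm_nonneg ε]
  set X : ℂ := -(2 * s * l)
  have hX : ‖X‖ ≤ 3 * ‖s‖ * ‖ε‖ := by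
    simp only [X, norm_neg, norm_mul, norm_real, Real.norm_eq_abs, RCLike.norm_ofNat]
    nlinarith [mul_le_mul_of_nonneg_left hle (norm_nonneg s)]
  have hexp : ‖exp X - 1 - X‖ ≤ 9 * ‖s‖ ^ 2 * Real.exp (2 * ‖s‖) * ‖ε‖ ^ 2 := by
    have h := norm_exp_sub_sum_le_norm_mul_exp X 2
    simp only [Finset.sum_range_succ, Finset.sum_range_zero, pow_zero, pow_one,
      Nat.factorial, Nat.cast_one, div_one, zero_add, mul_one] at h
    rw [sub_sub]
    refine h.trans ?_
    have h4 : ‖X‖ ≤ 2 * ‖s‖ := by nlinarith [norm_nonneg s]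
    calc ‖X‖ ^ 2 * Real.exp ‖X‖ ≤ (3 * ‖s‖ * ‖ε‖) ^ 2 * Real.exp (2 * ‖s‖) := by gcongr
      _ = _ := by ring
  have hc : ‖(starRingEnd ℂ) ε‖ = ‖ε‖ := norm_conj ε
  have hdecomp : heckeTerm s (1 + ε) - 1 + s * ε - (1 - s) * (starRingEnd ℂ) ε
      = (1 + (starRingEnd ℂ) ε) * (exp X - 1 - X) + X * (starRingEnd ℂ) ε
        - 2 * s * ((l - ε.re : ℝ) : ℂ) := by
    have hre : ε + (starRingEnd ℂ) ε = (2 * ε.re : ℝ) := add_conj ε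
    push_cast at hre ⊢
    rw [hterm]
    simp only [X]
    linear_combination s * hre
  rw [hdecomp]
  have b1 : ‖(1 + (starRingEnd ℂ) ε) * (exp X - 1 - X)‖
      ≤ 3 / 2 * (9 * ‖s‖ ^ 2 * Real.exp (2 * ‖s‖) * ‖ε‖ ^ 2) := by
    rw [norm_mul]
    have : ‖1 + (starRingEnd ℂ) ε‖ ≤ 3 / 2 := by
      refine (norm_add_le _ _).trans ?_
      rw [norm_one, hc]
      linarith
    gcongr
  have b2 : ‖X * (starRingEnd ℂ) ε‖ ≤ 3 * ‖s‖ * ‖ε‖ ^ 2 := by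
    rw [norm_mul, hc]
    nlinarith [mul_le_mul_of_nonneg_right hX (norm_nonneg ε)]
  have b3 : ‖2 * s * ((l - ε.re : ℝ) : ℂ)‖ ≤ 2 * ‖s‖ * ‖ε‖ ^ 2 := by
    simp only [norm_mul, norm_real, Real.norm_eq_abs, RCLike.norm_ofNat]
    gcongr
  have hpos : 0 ≤ ‖s‖ ^ 2 * Real.exp (2 * ‖s‖) * ‖ε‖ ^ 2 := by positivity
  refine (norm_sub_le _ _).trans ?_
  have := norm_add_le ((1 + (starRingEnd ℂ) ε) * (exp X - 1 - X)) (X * (starRingEnd ℂ) ε)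
  nlinarith

/-- The regularized term of the series for `∑ heckeTerm s (z + w)`. -/
def heckeReg (z s w : ℂ) : ℂ :=
  heckeTerm s (z + w) - heckeTerm s w + s * heckeTerm s w * (z / w)
    - (1 - s) * heckeTerm s w * (starRingEnd ℂ) (z / w)

lemma norm_heckeReg_le {z s w : ℂ} (hw0 : w ≠ 0) (hw : 2 * ‖z‖ ≤ ‖w‖) :
    ‖heckeReg z s w‖ ≤ (14 * ‖s‖ ^ 2 * Real.exp (2 * ‖s‖) + 5 * ‖s‖) * ‖z‖ ^ 2
      * ‖w‖ ^ (-1 - 2 * s.re) := by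
  have hw' := norm_pos_iff.mpr hw0
  have hε : ‖z / w‖ ≤ 1 / 2 := by
    rw [norm_div, div_le_iff₀ hw']
    linarith
  have h : heckeReg z s w = heckeTerm s w * (heckeTerm s (1 + z / w) - 1 + s * (z / w)
      - (1 - s) * (starRingEnd ℂ) (z / w)) := by
    rw [heckeReg, show z + w = w * (1 + z / w) by field_simp; ring, heckeTerm_mul]
    ring
  rw [h, norm_mul]
  refine (mul_le_mul (norm_heckeTerm_le s w) (norm_heckeTerm_expansion_le hε) (norm_nonneg _)
    (by positivity)).trans_eq ?_
  rw [show -1 - 2 * s.re = (1 - 2 * s.re) - (2 : ℕ) by push_cast; ring,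
    Real.rpow_sub_natCast hw'.ne', norm_div]
  ring

lemma differentiable_heckeReg (z w : ℂ) : Differentiable ℂ fun s ↦ heckeReg z s w := by
  have h := differentiable_heckeTerm
  simp only [heckeReg]
  exact (((h _).sub (h _)).add ((differentiable_id.mul (h _)).mul_const _)).sub
    ((((differentiable_const 1).sub differentiable_id).mul (h _)).mul_const _)

lemma eventually_norm_heckeReg_le (z : ℂ) (σ B : ℝ) :
    ∀ᶠ w : O4 in Filter.cofinite, ∀ s : ℂ, σ ≤ s.re → ‖s‖ ≤ B → ‖heckeReg z s w‖ ≤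
      (14 * B ^ 2 * Real.exp (2 * B) + 5 * B) * ‖z‖ ^ 2 * ‖(w : ℂ)‖ ^ (-1 - 2 * σ) := by
  rw [Filter.eventually_cofinite]
  refine (finite_norm_le_O4 (2 * ‖z‖ + 1)).subset fun w hw ↦ ?_
  by_contra hcon
  simp only [Set.mem_ofPred_eq, not_le] at hcon
  refine hw fun s hσ hsB ↦ ?_
  have hw0 : (w : ℂ) ≠ 0 := by
    intro h
    rw [h, norm_zero] at hcon
    nlinarith [norm_nonneg z]
  have hw1 : 1 ≤ ‖(w : ℂ)‖ := by linarith [norm_nonneg z]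
  refine (norm_heckeReg_le hw0 (by linarith)).trans ?_
  have hB : 0 ≤ B := (norm_nonneg s).trans hsB
  gcongr

lemma summable_heckeReg (z : ℂ) {s : ℂ} (hs : 1 / 2 < s.re) :
    Summable fun w : O4 ↦ heckeReg z s w :=
  .of_norm_bounded_eventually
    ((summable_norm_rpow_O4 (by linarith)).mul_left _)
    ((eventually_norm_heckeReg_le z s.re ‖s‖).mono fun _ h ↦ h s le_rfl le_rfl)

lemma differentiableOn_tsum_heckeReg (z : ℂ) :
    DifferentiableOn ℂ (fun s ↦ ∑' w : O4, heckeReg z s w) {s | 1 / 2 < s.re} := by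
  intro s₀ hs₀
  obtain ⟨σ, h1, h2⟩ := exists_between (show 1 / 2 < s₀.re from hs₀)
  set U : Set ℂ := {s | σ < s.re} ∩ Metric.ball 0 (‖s₀‖ + 1)
  have hU : IsOpen U := (isOpen_lt continuous_const continuous_re).inter Metric.isOpen_ball
  have hsU : s₀ ∈ U := ⟨h2, by simp⟩
  have hT := tendstoUniformlyOn_tsum_of_cofinite_eventually
    (f := fun (w : O4) (s : ℂ) ↦ heckeReg z s w) (s := U)
    ((summable_norm_rpow_O4 (by linarith)).mul_left _)
    ((eventually_norm_heckeReg_le z σ (‖s₀‖ + 1)).mono fun w h s hs ↦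
      h s hs.1.le (mem_ball_zero_iff.mp hs.2).le)
  have hd := hT.tendstoLocallyUniformlyOn.differentiableOn
    (.of_forall fun t ↦ DifferentiableOn.fun_sum fun w _ ↦
      (differentiable_heckeReg z w).differentiableOn) hU
  exact ((hd s₀ hsU).differentiableAt (hU.mem_nhds hsU)).differentiableWithinAt

end GaussianLattice

section HeckeSeries

open PeriodPair

/-- The Epstein zeta series of `ℤ[i]`. -/
def gaussZeta (s : ℂ) : ℂ := ∑' w : O4, (normSq (w : ℂ) : ℂ) ^ (-s)

lemma norm_normSq_cpow {s : ℂ} (hs : s.re ≠ 0) (u : ℂ) :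
    ‖(normSq u : ℂ) ^ (-s)‖ = ‖u‖ ^ (-2 * s.re) := by
  rcases eq_or_ne u 0 with rfl | hu
  · have h0 : -s ≠ 0 := fun h ↦ hs (by rw [neg_eq_zero.mp h, zero_re])
    rw [normSq_zero, ofReal_zero, zero_cpow h0, norm_zero, Real.zero_rpow (by simpa using hs)]
  · have hu' := norm_pos_iff.mpr hu
    rw [norm_cpow_eq_rpow_re_of_pos (normSq_pos.mpr hu), normSq_eq_norm_sq,
      ← Real.rpow_natCast, ← Real.rpow_mul hu'.le]
    simp

lemma summable_normSq_cpow {s : ℂ} (hs : 1 < s.re) :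
    Summable fun w : O4 ↦ (normSq (w : ℂ) : ℂ) ^ (-s) := by
  refine .of_norm ?_
  simp only [norm_normSq_cpow (show s.re ≠ 0 by linarith)]
  exact summable_norm_rpow_O4 (by linarith)

lemma differentiableOn_gaussZeta : DifferentiableOn ℂ gaussZeta {s | 1 < s.re} := by
  intro s₀ hs₀
  obtain ⟨σ, h1, h2⟩ := exists_between (show 1 < s₀.re from hs₀)
  have hU : IsOpen {s : ℂ | σ < s.re} := isOpen_lt continuous_const continuous_re
  have hd := differentiableOn_tsum_of_summable_norm (u := fun w : O4 ↦ ‖(w : ℂ)‖ ^ (-2 * σ))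
    (F := fun (w : O4) (s : ℂ) ↦ (normSq (w : ℂ) : ℂ) ^ (-s)) (U := {s : ℂ | σ < s.re})
    (summable_norm_rpow_O4 (by linarith)) (fun w s hs ↦ ?_) hU fun w s hs ↦ ?_
  · exact ((hd s₀ h2).differentiableAt (hU.mem_nhds h2)).differentiableWithinAt
  · refine (DifferentiableAt.const_cpow differentiableAt_fun_id.neg ?_).differentiableWithinAt
    right
    intro h
    have hs : σ < s.re := hs
    rw [show s = 0 from neg_eq_zero.mp h, zero_re] at hs
    linarith
  · have hs : σ < s.re := hs
    rw [norm_normSq_cpow (show s.re ≠ 0 by linarith)]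
    by_cases hw : w = 0
    · rw [hw, ZeroMemClass.coe_zero, norm_zero, Real.zero_rpow (by linarith)]
      positivity
    · have hw1 : 1 ≤ ‖(w : ℂ)‖ := by
        obtain ⟨m, rfl⟩ := gaussEquiv.surjective w
        rw [← one_le_sq_iff₀ (norm_nonneg _), ← normSq_eq_norm_sq]
        have hm : m ≠ 0 := by
          rintro rfl
          exact hw (Subtype.ext (by simp [gaussEquiv_apply]))
        have h3 : 1 ≤ m.1 ^ 2 + m.2 ^ 2 := by
          by_contra hcon
          have a1 : m.1 = 0 := by nlinarith [sq_nonneg m.1, sq_nonneg m.2]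
          have a2 : m.2 = 0 := by nlinarith [sq_nonneg m.1, sq_nonneg m.2]
          exact hm (Prod.ext a1 a2)
        rw [gaussEquiv_apply, normSq_apply]
        have h4 : (1 : ℝ) ≤ (m.1 : ℝ) ^ 2 + (m.2 : ℝ) ^ 2 := by exact_mod_cast h3
        simp
        nlinarith
      exact Real.rpow_le_rpow_of_exponent_le hw1 (by linarith)

lemma summable_heckeTerm_add {s : ℂ} (hs : 3 / 2 < s.re) (z : ℂ) :
    Summable fun w : O4 ↦ heckeTerm s (z + w) :=
  .of_norm_bounded (summable_norm_add_rpow_O4 (by linarith) z) fun _ ↦ norm_heckeTerm_le _ _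

lemma summable_heckeTerm {s : ℂ} (hs : 3 / 2 < s.re) :
    Summable fun w : O4 ↦ heckeTerm s (w : ℂ) := by
  simpa using summable_heckeTerm_add hs 0

lemma tsum_heckeTerm (s : ℂ) : ∑' w : O4, heckeTerm s (w : ℂ) = 0 := by
  rw [← CharZero.eq_neg_self_iff, ← tsum_neg, ← (Equiv.neg O4).tsum_eq]
  simp [heckeTerm_neg]

/-- Multiplication by `i` on `ℤ[i]`. -/
def gaussRot : O4 ≃ O4 where
  toFun w := ⟨I * w, mul_mem I_mem_O4 w.2⟩
  invFun w := ⟨-I * w, mul_mem (neg_mem I_mem_O4) w.2⟩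
  left_inv w := Subtype.ext (by simp [← mul_assoc])
  right_inv w := Subtype.ext (by simp [← mul_assoc])

lemma tsum_heckeTerm_div (s : ℂ) : ∑' w : O4, heckeTerm s (w : ℂ) / w = 0 := by
  rw [← CharZero.eq_neg_self_iff, ← tsum_neg, ← gaussRot.tsum_eq]
  refine tsum_congr fun w ↦ ?_
  simp only [gaussRot, Equiv.coe_fn_mk, heckeTerm_I_mul]
  rw [neg_mul, neg_div, mul_div_mul_left _ _ I_ne_zero]

lemma heckeTerm_mul_conj_div {s : ℂ} (hs : s ≠ 0) (z w : ℂ) :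
    heckeTerm s w * (starRingEnd ℂ) (z / w)
      = (starRingEnd ℂ) z * (normSq w : ℂ) ^ (-s) := by
  rcases eq_or_ne w 0 with rfl | hw
  · simp [hs]
  · have : (starRingEnd ℂ) w ≠ 0 := by simpa using hw
    rw [heckeTerm, map_div₀]
    field_simp

lemma summable_heckeTerm_div {s : ℂ} (hs : 1 < s.re) :
    Summable fun w : O4 ↦ heckeTerm s (w : ℂ) / w := by
  refine .of_norm_bounded (summable_normSq_cpow hs).norm fun w ↦ ?_
  rw [heckeTerm, norm_div, norm_mul, norm_conj]
  by_cases hw : (w : ℂ) = 0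
  · simp [hw]
  · rw [mul_div_cancel_left₀ _ (norm_ne_zero_iff.mpr hw)]

lemma tsum_heckeTerm_add {s : ℂ} (hs : 3 / 2 < s.re) (z : ℂ) :
    ∑' w : O4, heckeTerm s (z + w) = ∑' w : O4, heckeReg z s w
      + (1 - s) * ((starRingEnd ℂ) z * gaussZeta s) := by
  have hs1 : 1 < s.re := by linarith
  have hs0 : s ≠ 0 := by
    rintro rfl
    norm_num at hs
  have h1 := (summable_heckeTerm_add hs z).hasSum
  have h2 := (summable_heckeTerm hs).hasSum
  have h3 := (summable_heckeTerm_div hs1).hasSum.mul_left (s * z)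
  have h4 := ((summable_normSq_cpow hs1).hasSum.mul_left ((starRingEnd ℂ) z)).mul_left (1 - s)
  rw [tsum_heckeTerm] at h2
  rw [tsum_heckeTerm_div] at h3
  have h5 := ((h1.sub h2).add h3).sub h4
  have h6 (w : O4) : heckeReg z s w = heckeTerm s (z + w) - heckeTerm s w
      + s * z * (heckeTerm s w / w)
      - (1 - s) * ((starRingEnd ℂ) z * (normSq (w : ℂ) : ℂ) ^ (-s)) := by
    rw [heckeReg, mul_assoc (1 - s), heckeTerm_mul_conj_div hs0]
    ring
  rw [tsum_congr h6, h5.tsum_eq, gaussZeta]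
  ring

lemma heckeReg_one (z w : ℂ) : heckeReg z 1 w = (z + w)⁻¹ - w⁻¹ + z * (w ^ 2)⁻¹ := by
  rw [heckeReg, heckeTerm_one_left, heckeTerm_one_left]
  ring

lemma tsum_heckeReg_one (z : ℂ) :
    ∑' w : O4, heckeReg z 1 w = varpi * wzeta4 (varpi * z) := by
  have hv := varpi_ne_zero
  have hsum := (summable_heckeReg z (s := 1) (by norm_num)).comp_injective
    ((Equiv.neg (ℤ × ℤ)).trans gaussEquiv).injective
  rw [← ((Equiv.neg (ℤ × ℤ)).trans gaussEquiv).tsum_eq]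
  refine (hsum.tsum_eq_add_tsum_ite 0).trans ?_
  rw [wzeta4, mul_add, ← tsum_mul_left]
  have hg (m : ℤ × ℤ) : (gaussEquiv (-m) : ℂ) = -(ω4 m / varpi) := by
    rw [gaussEquiv_apply, ω4, mul_div_cancel_left₀ _ hv]
    simp
    ring
  congr 1
  · simp only [Function.comp_apply, Equiv.trans_apply, Equiv.neg_apply, hg, heckeReg_one]
    simp [ω4]
    rw [mul_left_comm, mul_inv_cancel₀ hv, mul_one]
  · refine tsum_congr fun m ↦ ?_
    split_ifs with h
    · simp
    · simp only [Function.comp_apply, Equiv.trans_apply, Equiv.neg_apply, hg, heckeReg_one]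
      rw [show z + -(ω4 m / varpi) = (varpi * z - ω4 m) / varpi by field_simp; ring]
      simp only [inv_neg, inv_div, even_two, Even.neg_pow, div_pow]
      field_simp
      ring

end HeckeSeries

section GaussianCircle

open Filter Topology MeasureTheory Module

/-- The lattice `ℤ[i]` as a `ℤ`-submodule of `ℂ`. -/
abbrev gaussLattice : Submodule ℤ ℂ := Submodule.span ℤ (Set.range basisOneI)

lemma mem_gaussLattice {z : ℂ} : z ∈ gaussLattice ↔ z ∈ O4 := by
  rw [mem_O4, Basis.mem_span_iff_repr_mem ℤ, Fin.forall_fin_two]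
  simp only [basisOneI, Set.mem_range]
  constructor
  · rintro ⟨⟨m, hm⟩, n, hn⟩
    refine ⟨m, n, Complex.ext ?_ ?_⟩
    · simpa using hm.symm
    · simpa using hn.symm
  · rintro ⟨m, n, rfl⟩
    exact ⟨⟨m, by simp⟩, n, by simp⟩

lemma covolume_gaussLattice : ZLattice.covolume gaussLattice = 1 := by
  rw [ZLattice.covolume_eq_measure_fundamentalDomain _ _
    (ZSpan.isAddFundamentalDomain basisOneI volume),
    measureReal_congr (ZSpan.fundamentalDomain_ae_parallelepiped _ volume),
    ← toBasis_orthonormalBasisOneI, measureReal_def, OrthonormalBasis.coe_toBasis,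
    OrthonormalBasis.volume_parallelepiped, ENNReal.toReal_one]

/-- The norm of a Gaussian integer as a natural number. -/
def gaussNorm (w : O4) : ℕ :=
  ((gaussEquiv.symm w).1 ^ 2 + (gaussEquiv.symm w).2 ^ 2).toNat

lemma gaussNorm_cast (w : O4) : (gaussNorm w : ℝ) = normSq (w : ℂ) := by
  obtain ⟨m, rfl⟩ := gaussEquiv.surjective w
  have h : ((gaussNorm (gaussEquiv m) : ℕ) : ℤ) = m.1 ^ 2 + m.2 ^ 2 := by
    rw [gaussNorm, Equiv.symm_apply_apply, Int.toNat_of_nonneg (by positivity)]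
  rw [← Int.cast_natCast, h, gaussEquiv_apply, normSq_apply]
  simp
  ring

lemma gaussNorm_eq_zero {w : O4} : gaussNorm w = 0 ↔ w = 0 := by
  rw [← Nat.cast_eq_zero (R := ℝ), gaussNorm_cast]
  simp

lemma tendsto_card_normSq_le : Tendsto
    (fun c : ℝ ↦ Nat.card ({z : ℂ | normSq z ≤ c} ∩ (O4 : Set ℂ) : Set ℂ) / c) atTop
    (𝓝 Real.pi) := by
  have hball : {z : ℂ | z ∈ Set.univ ∧ normSq z ≤ 1} = Metric.closedBall 0 1 := by
    ext z
    simp [normSq_eq_norm_sq]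
  have h := ZLattice.covolume.tendsto_card_le_div' gaussLattice (X := Set.univ)
    (F := fun z ↦ normSq z) (by simp) (fun x r hr ↦ by
      simp [mul_pow, normSq_eq_norm_sq])
    (by rw [hball]; exact Metric.isBounded_closedBall)
    (by rw [hball]; exact measurableSet_closedBall)
    (by rw [hball, frontier_closedBall _ one_ne_zero]; exact Measure.addHaar_sphere _ _ _)
  rw [hball, covolume_gaussLattice, measureReal_def, Complex.volume_closedBall] at h
  have hset : (gaussLattice : Set ℂ) = (O4 : Set ℂ) := Set.ext fun z ↦ mem_gaussLattice
  simpa [hset] using h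

lemma tendsto_sum_card_gaussNorm : Tendsto
    (fun n : ℕ ↦ (∑ k ∈ Finset.Icc 1 n, (Nat.card {w : O4 // gaussNorm w = k} : ℝ)) / n) atTop
    (𝓝 Real.pi) := by
  have h := (tendsto_card_normSq_le.comp tendsto_natCast_atTop_atTop).sub
    (tendsto_const_div_atTop_nhds_zero_nat (1 : ℝ))
  rw [sub_zero] at h
  refine h.congr fun n ↦ ?_
  rw [Function.comp_apply, ← sub_div]
  congr 1
  rw [sub_eq_iff_eq_add, ← Nat.cast_sum]
  norm_cast
  have hfin : ∀ k ∈ Finset.Icc 0 n, {w : O4 | gaussNorm w = k}.Finite := by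
    refine fun k _ ↦ (finite_norm_le_O4 (√k)).subset fun w hw ↦ ?_
    have hw : gaussNorm w = k := hw
    rw [Set.mem_ofPred_eq, ← hw, gaussNorm_cast, normSq_eq_norm_sq, Real.sqrt_sq (norm_nonneg _)]
  have h0 : Nat.card {w : O4 // gaussNorm w = 0} = 1 := by
    simp [gaussNorm_eq_zero]
  rw [show Finset.Icc 1 n = Finset.Ioc 0 n from Finset.Icc_succ_left_eq_Ioc _ _, ← h0,
    Finset.sum_Ioc_add_eq_sum_Icc n.zero_le, ← Finset.card_preimage_eq_sum_card_image_eq hfin]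
  refine Nat.card_congr ⟨fun z ↦ ⟨⟨z, z.2.2⟩, ?_⟩, fun w ↦ ⟨w.1, ?_, w.1.2⟩, fun _ ↦ rfl,
    fun _ ↦ rfl⟩
  · have := z.2.1
    rw [Set.mem_ofPred_eq, ← gaussNorm_cast ⟨z, z.2.2⟩] at this
    simpa using this
  · have := w.2
    rw [Set.mem_ofPred_eq, ← gaussNorm_cast]
    simpa using this

lemma gaussZeta_eq_LSeries {s : ℂ} (hs : 1 < s.re) :
    gaussZeta s = LSeries (fun n ↦ ((Nat.card {w : O4 // gaussNorm w = n} : ℝ) : ℂ)) s := by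
  have hs0 : s ≠ 0 := by
    rintro rfl
    norm_num at hs
  have h := ((Equiv.sigmaFiberEquiv gaussNorm).hasSum_iff.mpr
    (summable_normSq_cpow hs).hasSum)
  rw [gaussZeta, ← h.tsum_eq, h.summable.tsum_sigma, LSeries]
  refine tsum_congr fun n ↦ ?_
  have h1 (w : {w : O4 // gaussNorm w = n}) :
      ((fun w : O4 ↦ (normSq (w : ℂ) : ℂ) ^ (-s)) ∘ Equiv.sigmaFiberEquiv gaussNorm) ⟨n, w⟩
        = (n : ℂ) ^ (-s) := by
    simp only [Function.comp_apply, Equiv.sigmaFiberEquiv_apply, ← gaussNorm_cast, w.2]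
    simp
  rw [tsum_congr h1, tsum_const, LSeries.term_def]
  split_ifs with h0
  · simp [h0, hs0]
  · rw [nsmul_eq_mul, cpow_neg, div_eq_mul_inv]
    simp

lemma tendsto_sub_one_mul_gaussZeta :
    Tendsto (fun s : ℝ ↦ ((s : ℂ) - 1) * gaussZeta s) (𝓝[>] 1) (𝓝 (Real.pi : ℂ)) := by
  have h := LSeries_tendsto_sub_mul_nhds_one_of_tendsto_sum_div_and_nonneg
    (fun n ↦ (Nat.card {w : O4 // gaussNorm w = n} : ℝ)) tendsto_sum_card_gaussNorm
    fun _ ↦ Nat.cast_nonneg _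
  refine h.congr' ?_
  filter_upwards [self_mem_nhdsWithin] with s hs
  rw [gaussZeta_eq_LSeries (by simpa using hs)]

end GaussianCircle

section HeckeValue

open Filter Topology

/-- The value at `s = 1` of a continuation of a finite combination of shifted Hecke series. -/
lemma value_one_of_eq_tsum_heckeTerm {ι : Type*} (J : Finset ι) (c z : ι → ℂ) (A B : ℂ)
    {F : ℂ → ℂ} (hF : DifferentiableOn ℂ F {s : ℂ | 0 < s.re})
    (hFs : ∀ s : ℂ, 3 / 2 < s.re →
      F s = A * heckeTerm s B * ∑ j ∈ J, c j * ∑' w : O4, heckeTerm s (z j + w)) :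
    F 1 = A * B⁻¹ * ∑ j ∈ J, c j * (varpi * Z4 (z j)) := by
  set G : ℂ → ℂ := fun s ↦ A * heckeTerm s B * ∑ j ∈ J, c j *
    (∑' w : O4, heckeReg (z j) s w + (1 - s) * ((starRingEnd ℂ) (z j) * gaussZeta s)) with hG
  have hGd : DifferentiableOn ℂ G {s : ℂ | 1 < s.re} := by
    refine (((differentiable_heckeTerm B).differentiableOn).const_mul A).mul
      (DifferentiableOn.fun_sum fun j _ ↦ DifferentiableOn.const_mul (.add ?_ ?_) _)
    · exact (differentiableOn_tsum_heckeReg _).mono fun s (hs : 1 < s.re) ↦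
        show 1 / 2 < s.re by linarith
    · exact ((differentiableOn_const 1).sub differentiableOn_id).mul
        (differentiableOn_gaussZeta.const_mul _)
  have hopen (a : ℝ) : IsOpen {s : ℂ | a < s.re} := isOpen_lt continuous_const continuous_re
  have hF1 : DifferentiableOn ℂ F {s : ℂ | 1 < s.re} :=
    hF.mono fun s (hs : 1 < s.re) ↦ show 0 < s.re by linarith
  have heq : Set.EqOn F G {s : ℂ | 1 < s.re} := by
    refine (hF1.analyticOnNhd (hopen 1)).eqOn_of_preconnected_of_eventuallyEq
      (hGd.analyticOnNhd (hopen 1)) (convex_halfSpace_re_gt 1).isPreconnected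
      (z₀ := 2) (by simp) ?_
    filter_upwards [(hopen (3 / 2)).mem_nhds (show (2 : ℂ) ∈ _ by norm_num)] with s hs
    rw [hFs s hs, hG]
    simp only [tsum_heckeTerm_add hs]
  have hofReal : Tendsto (fun s : ℝ ↦ (s : ℂ)) (𝓝[>] 1) (𝓝 1) := by
    have := (continuous_ofReal.tendsto 1).mono_left (nhdsWithin_le_nhds (s := Set.Ioi (1 : ℝ)))
    simpa using this
  have hFt : Tendsto (fun s : ℝ ↦ F s) (𝓝[>] 1) (𝓝 (F 1)) :=
    (hF.differentiableAt ((hopen 0).mem_nhds (by simp))).continuousAt.tendsto.comp hofReal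
  have hGt : Tendsto (fun s : ℝ ↦ G s) (𝓝[>] 1) (𝓝 (A * heckeTerm 1 B * ∑ j ∈ J, c j *
      (∑' w : O4, heckeReg (z j) 1 w - (starRingEnd ℂ) (z j) * Real.pi))) := by
    refine ((((differentiable_heckeTerm B 1).continuousAt.tendsto.comp hofReal).const_mul A).mul
      (tendsto_finsetSum _ fun j _ ↦ Tendsto.const_mul _ ?_))
    have h1 := ((differentiableOn_tsum_heckeReg (z j)).differentiableAt
      ((hopen (1 / 2)).mem_nhds (show (1 : ℂ) ∈ _ by norm_num))).continuousAt.tendsto.comp hofReal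
    have h2 := tendsto_sub_one_mul_gaussZeta.const_mul ((starRingEnd ℂ) (z j))
    refine (h1.sub h2).congr fun s ↦ ?_
    simp only [Function.comp_apply]
    ring
  have hlim : F 1 = _ := tendsto_nhds_unique (hFt.congr' <| by
    filter_upwards [self_mem_nhdsWithin] with s hs
    exact heq (by simpa using hs)) hGt
  rw [hlim, heckeTerm_one_left]
  congr 1
  refine Finset.sum_congr rfl fun j _ ↦ ?_
  have hv := varpi_ne_zero
  rw [tsum_heckeReg_one, Z4]
  push_cast
  field_simp

end HeckeValue

section GaussianResidues

lemma conj_mem_O4 {z : ℂ} (hz : z ∈ O4) : (starRingEnd ℂ) z ∈ O4 := by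
  obtain ⟨m, n, rfl⟩ := mem_O4.mp hz
  exact mem_O4.mpr ⟨m, -n, by simp⟩

lemma exists_int_normSq {z : ℂ} (hz : z ∈ O4) :
    ∃ n : ℤ, z * (starRingEnd ℂ) z = n := by
  obtain ⟨m, n, rfl⟩ := mem_O4.mp hz
  refine ⟨m ^ 2 + n ^ 2, ?_⟩
  simp
  linear_combination -(n : ℂ) ^ 2 * I_sq

lemma GCong.refl (a c : ℂ) : GCong a a c := ⟨0, zero_mem _, by ring⟩

lemma GCong.symm {a b c : ℂ} (h : GCong a b c) : GCong b a c := by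
  obtain ⟨d, hd, h⟩ := h
  exact ⟨-d, neg_mem hd, by linear_combination -h⟩

lemma GCong.trans {a b c m : ℂ} (h : GCong a b m) (h' : GCong b c m) : GCong a c m := by
  obtain ⟨d, hd, h⟩ := h
  obtain ⟨e, he, h'⟩ := h'
  exact ⟨d + e, add_mem hd he, by linear_combination h + h'⟩

lemma GCong.mul_left {a b c m : ℂ} (hc : c ∈ O4) (h : GCong a b m) :
    GCong (c * a) (c * b) m := by
  obtain ⟨d, hd, h⟩ := h
  exact ⟨c * d, mul_mem hc hd, by linear_combination c * h⟩

lemma GCong.of_mul_left {a b c m : ℂ} (ha : a ∈ O4) (hb : b ∈ O4) (hc : GCoprime c m)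
    (h : GCong (c * a) (c * b) m) : GCong a b m := by
  obtain ⟨d, hd, h⟩ := h
  obtain ⟨u, hu, v, hv, e⟩ := hc
  exact ⟨u * d + v * (a - b), add_mem (mul_mem hu hd) (mul_mem hv (sub_mem ha hb)),
    by linear_combination (b - a) * e + u * h⟩

variable {p : ℕ} {π : ℂ}

lemma GCong.dvd (hp : p.Prime) (hnorm : (p : ℂ) = π * (starRingEnd ℂ) π) {a b : ℤ}
    (h : GCong a b π) : (p : ℤ) ∣ a - b := by
  obtain ⟨d, hd, h⟩ := h
  obtain ⟨n, hn⟩ := exists_int_normSq hd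
  have h' : (a - b : ℂ) = (starRingEnd ℂ) π * (starRingEnd ℂ) d := by
    rw [← map_mul, ← h]
    simp
  have h2 : (a - b) * (a - b) = (p : ℤ) * n := by
    have : (((a - b) * (a - b) : ℤ) : ℂ) = ((p * n : ℤ) : ℂ) := by
      push_cast
      rw [hnorm, ← hn]
      linear_combination (a - b) * h + π * d * h'
    exact_mod_cast this
  have := (Nat.prime_iff_prime_int.mp hp).dvd_or_dvd (Dvd.intro _ h2.symm)
  exact this.elim id id

lemma prime_ne_zero (hp : p.Prime) (hnorm : (p : ℂ) = π * (starRingEnd ℂ) π) : π ≠ 0 := by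
  rintro rfl
  rw [zero_mul, Nat.cast_eq_zero] at hnorm
  exact hp.ne_zero hnorm

lemma exists_nat_gcong (hp : p.Prime) (hπ : π ∈ O4) (hnorm : (p : ℂ) = π * (starRingEnd ℂ) π)
    {x : ℂ} (hx : x ∈ O4) : ∃ r < p, GCong x r π := by
  obtain ⟨a, b, hab⟩ := mem_O4.mp hπ
  have hpc : (starRingEnd ℂ) π ∈ O4 := conj_mem_O4 hπ
  have hpab : (p : ℤ) = a ^ 2 + b ^ 2 := by
    have : ((p : ℤ) : ℂ) = ((a ^ 2 + b ^ 2 : ℤ) : ℂ) := by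
      push_cast
      rw [hnorm, hab]
      simp
      linear_combination -(b : ℂ) ^ 2 * I_sq
    exact_mod_cast this
  have hpZ := Nat.prime_iff_prime_int.mp hp
  have hb : ¬ (p : ℤ) ∣ b := by
    rintro ⟨c, hc⟩
    have ha : (p : ℤ) ∣ a := by
      refine hpZ.dvd_of_dvd_pow (n := 2) ⟨1 - p * c ^ 2, ?_⟩
      rw [hc] at hpab
      linear_combination -hpab
    obtain ⟨d, hd⟩ := ha
    refine hpZ.not_dvd_one ⟨d ^ 2 + c ^ 2, ?_⟩
    have := hpZ.ne_zero
    refine mul_left_cancel₀ this ?_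
    rw [hc, hd] at hpab
    linear_combination hpab
  obtain ⟨u, v, huv⟩ := (Int.isCoprime_iff_gcd_eq_one.mpr
    ((hp.coprime_iff_not_dvd (n := b.natAbs)).mpr fun h ↦ hb (Int.natCast_dvd.mpr h)) :
      IsCoprime (p : ℤ) b)
  obtain ⟨m, n, rfl⟩ := mem_O4.mp hx
  have huv' : (u * (π * (starRingEnd ℂ) π) + v * b : ℂ) = 1 := by
    rw [← hnorm]
    exact_mod_cast huv
  set t : ℤ := m - n * (v * a)
  refine ⟨(t % p).toNat, ?_, ?_⟩
  · have := Int.emod_lt_of_pos t (show (0 : ℤ) < p by exact_mod_cast hp.pos)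
    have := Int.emod_nonneg t hpZ.ne_zero
    lia
  · have hcast : (((t % p).toNat : ℕ) : ℂ) = t - π * (starRingEnd ℂ) π * (t / (p : ℤ) : ℤ) := by
      have h1 : (((t % p).toNat : ℕ) : ℤ) = t - p * (t / p) := by
        rw [Int.toNat_of_nonneg (Int.emod_nonneg t hpZ.ne_zero), Int.emod_def]
      rw [← hnorm, ← Int.cast_natCast, h1]
      push_cast
      ring
    rw [hcast]
    refine ⟨n * v + n * I * u * (starRingEnd ℂ) π + (starRingEnd ℂ) π * (t / (p : ℤ) : ℤ), ?_, ?_⟩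
    · have hi := I_mem_O4
      have hc (k : ℤ) : (k : ℂ) ∈ O4 := intCast_mem _ k
      exact add_mem (add_mem (mul_mem (hc _) (hc _))
        (mul_mem (mul_mem (mul_mem (hc _) hi) (hc _)) hpc)) (mul_mem hpc (hc _))
    · simp only [t]
      push_cast
      linear_combination -(n : ℂ) * v * hab - n * I * huv'

lemma coprime_natCast (hp : p.Prime) (hπ : π ∈ O4) (hnorm : (p : ℂ) = π * (starRingEnd ℂ) π)
    {r : ℕ} (hr : ¬ p ∣ r) : GCoprime r π := by
  obtain ⟨u, v, huv⟩ := Nat.isCoprime_iff_coprime.mpr ((hp.coprime_iff_not_dvd).mpr hr)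
  refine ⟨v, intCast_mem _ v, u * (starRingEnd ℂ) π,
    mul_mem (intCast_mem _ u) (conj_mem_O4 hπ), ?_⟩
  rw [mul_assoc, mul_comm _ π, ← hnorm]
  have : ((u * (p : ℤ) + v * (r : ℤ) : ℤ) : ℂ) = 1 := by rw [huv]; simp
  push_cast at this
  linear_combination this

lemma not_coprime_of_gcong_zero (hp : p.Prime) (hnorm : (p : ℂ) = π * (starRingEnd ℂ) π)
    {x : ℂ} (h : GCong x 0 π) : ¬ GCoprime x π := by
  rintro ⟨u, hu, v, hv, e⟩
  obtain ⟨d, hd, h⟩ := h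
  have h1 : GCong (1 : ℤ) (0 : ℤ) π :=
    ⟨u * d + v, add_mem (mul_mem hu hd) hv, by push_cast; linear_combination u * h - e⟩
  have := h1.dvd hp hnorm
  exact (Nat.prime_iff_prime_int.mp hp).not_dvd_one (by simpa using this)

lemma exists_mem_Icc_gcong (hp : p.Prime) (hπ : π ∈ O4)
    (hnorm : (p : ℂ) = π * (starRingEnd ℂ) π) {x : ℂ} (hx : x ∈ O4) (hx' : GCoprime x π) :
    ∃ r ∈ Finset.Icc 1 (p - 1), GCong x (r : ℕ) π := by
  obtain ⟨r, hr, h⟩ := exists_nat_gcong hp hπ hnorm hx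
  refine ⟨r, Finset.mem_Icc.mpr ⟨Nat.one_le_iff_ne_zero.mpr ?_, by lia⟩, h⟩
  rintro rfl
  exact not_coprime_of_gcong_zero hp hnorm (by simpa using h) hx'

lemma eq_of_gcong (hp : p.Prime) (hnorm : (p : ℂ) = π * (starRingEnd ℂ) π) {r r' : ℕ}
    (hr : r ∈ Finset.Icc 1 (p - 1)) (hr' : r' ∈ Finset.Icc 1 (p - 1))
    (h : GCong (r : ℂ) (r' : ℂ) π) : r = r' := by
  rw [Finset.mem_Icc] at hr hr'
  have h := GCong.dvd hp hnorm (a := r) (b := r') (by simpa using h)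
  have := Int.eq_zero_of_abs_lt_dvd h (by rw [abs_lt]; lia)
  lia

lemma not_dvd_of_mem_Icc {r : ℕ} (hr : r ∈ Finset.Icc 1 (p - 1)) : ¬ p ∣ r := by
  rw [Finset.mem_Icc] at hr
  exact fun h ↦ by have := Nat.le_of_dvd (by lia) h; lia

/-- Multiplication by `g` permutes the nonzero residues modulo `π`. -/
lemma sum_mul_eq (hp : p.Prime) (hπ : π ∈ O4) (hnorm : (p : ℂ) = π * (starRingEnd ℂ) π)
    {g : ℂ} (hg : g ∈ O4) (hg' : GCoprime g π) (f : ℂ → ℂ)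
    (hf : ∀ a ∈ O4, ∀ b ∈ O4, GCong a b π → f a = f b) :
    ∑ r ∈ Finset.Icc 1 (p - 1), f (g * (r : ℕ)) = ∑ r ∈ Finset.Icc 1 (p - 1), f (r : ℕ) := by
  have hO (r : ℕ) : (r : ℂ) ∈ O4 := natCast_mem _ r
  have hcop (r : ℕ) (hr : r ∈ Finset.Icc 1 (p - 1)) : GCoprime (g * r) π := by
    obtain ⟨u, hu, v, hv, e⟩ := hg'
    obtain ⟨u', hu', v', hv', e'⟩ := coprime_natCast hp hπ hnorm (not_dvd_of_mem_Icc hr)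
    exact ⟨u * u', mul_mem hu hu', u * g * v' + v * u' * r + v * v' * π,
      add_mem (add_mem (mul_mem (mul_mem hu hg) hv') (mul_mem (mul_mem hv hu') (hO r)))
        (mul_mem (mul_mem hv hv') hπ), by linear_combination e * (u' * r + v' * π) + e'⟩
  choose! σ hσ hσ' using fun r hr ↦ exists_mem_Icc_gcong hp hπ hnorm (mul_mem hg (hO r)) (hcop r hr)
  have hinj : Set.InjOn σ (Finset.Icc 1 (p - 1)) := by
    intro r hr r' hr' h
    refine eq_of_gcong hp hnorm hr hr' (.of_mul_left (hO r) (hO r') hg' ?_)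
    have h2 := hσ' r' hr'
    rw [← h] at h2
    exact (hσ' r hr).trans h2.symm
  refine Finset.sum_nbij σ hσ hinj
    (Finset.surjOn_of_injOn_of_card_le σ hσ hinj le_rfl) fun r hr ↦ ?_
  exact hf _ (mul_mem hg (hO r)) _ (hO _) (hσ' r hr)

end GaussianResidues

section ResidueDecomposition

variable {p : ℕ} {π γ : ℂ} {χ ρ : ℂ → ℂ} {K : Finset ℂ}

lemma coprime_of_gcong_one {π γ : ℂ} (h : GCong π 1 γ) : GCoprime γ π := by
  obtain ⟨d, hd, h⟩ := h
  exact ⟨-d, neg_mem hd, 1, one_mem _, by linear_combination h⟩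

lemma tsum_residue_decomposition (hp : p.Prime) (hπ : π ∈ O4)
    (hnorm : (p : ℂ) = π * (starRingEnd ℂ) π) (hχ : IsResChar4 π χ) (hγ : γ ∈ O4) (hγ0 : γ ≠ 0)
    (hπγ : GCong π 1 γ) (hρ : ∀ a ∈ O4, ∀ b ∈ O4, GCong a b γ → ρ a = ρ b)
    (hK : ∀ k ∈ K, k ∈ O4) (hKρ : ∀ x ∈ O4, ρ x ≠ 0 → ∃ k ∈ K, GCong x k γ)
    (hKinj : ∀ k ∈ K, ∀ k' ∈ K, GCong k k' γ → k = k') {s : ℂ} (hs : 3 / 2 < s.re) :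
    ∑' ν : O4, χ ν * ρ ν * heckeTerm s ν = χ γ * heckeTerm s (γ * π) *
      ∑ j ∈ Finset.Icc 1 (p - 1) ×ˢ K, χ (j.1 : ℕ) * ρ j.2 *
        ∑' w : O4, heckeTerm s ((j.1 : ℂ) / π + j.2 / γ + w) := by
  have hπ0 := prime_ne_zero hp hnorm
  have hcop := coprime_of_gcong_one hπγ
  have hO (r : ℕ) : (r : ℂ) ∈ O4 := natCast_mem _ r
  set J := Finset.Icc 1 (p - 1) ×ˢ K with hJ
  have hJK (j : J) : j.1.2 ∈ O4 := hK _ (Finset.mem_product.mp j.2).2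
  let Φ : J × O4 → O4 := fun x ↦ ⟨γ * (x.1.1.1 : ℕ) + π * x.1.1.2 + γ * π * x.2,
    add_mem (add_mem (mul_mem hγ (hO _)) (mul_mem hπ (hJK _)))
      (mul_mem (mul_mem hγ hπ) x.2.2)⟩
  have hΦπ (x : J × O4) : GCong (Φ x) (γ * (x.1.1.1 : ℕ)) π :=
    ⟨x.1.1.2 + γ * x.2, add_mem (hJK _) (mul_mem hγ x.2.2), by simp only [Φ]; ring⟩
  have hΦγ (x : J × O4) : GCong (Φ x) x.1.1.2 γ := by
    obtain ⟨d, hd, e⟩ := hπγ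
    exact ⟨(x.1.1.1 : ℕ) + d * x.1.1.2 + π * x.2, add_mem (add_mem (hO _) (mul_mem hd (hJK _)))
      (mul_mem hπ x.2.2), by simp only [Φ]; linear_combination x.1.1.2 * e⟩
  have hinj : Function.Injective Φ := by
    intro x y h
    have h1 := hΦπ x
    have h2 := hΦγ x
    rw [h] at h1 h2
    have hx := Finset.mem_product.mp x.1.2
    have hy := Finset.mem_product.mp y.1.2
    have e1 : x.1.1.1 = y.1.1.1 := eq_of_gcong hp hnorm hx.1 hy.1
      (.of_mul_left (hO _) (hO _) hcop (h1.symm.trans (hΦπ y)))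
    have e2 : x.1.1.2 = y.1.1.2 := hKinj _ hx.2 _ hy.2 (h2.symm.trans (hΦγ y))
    have h3 := Subtype.ext_iff.mp h
    simp only [Φ, e1, e2] at h3
    exact Prod.ext (Subtype.ext (Prod.ext e1 e2))
      (Subtype.ext (mul_left_cancel₀ (mul_ne_zero hγ0 hπ0) (by linear_combination h3)))
  have hsupp : Function.support (fun ν : O4 ↦ χ ν * ρ ν * heckeTerm s ν) ⊆ Set.range Φ := by
    intro ν hν
    rw [Function.mem_support] at hν
    have hχν : χ ν ≠ 0 := fun h ↦ hν (by simp [h])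
    have hρν : ρ ν ≠ 0 := fun h ↦ hν (by simp [h])
    have hνc : GCoprime ν π := by
      by_contra h
      exact hχν (hχ.vanish _ ν.2 h)
    obtain ⟨u, hu, v, hv, e⟩ := hcop
    obtain ⟨a, ha, b, hb, e'⟩ := hνc
    have huν : GCoprime (u * ν) π :=
      ⟨a * γ, mul_mem ha hγ, a * ν * v + b,
        add_mem (mul_mem (mul_mem ha ν.2) hv) hb, by linear_combination a * ν * e + e'⟩
    obtain ⟨r, hr, d, hd, hrd⟩ := exists_mem_Icc_gcong hp hπ hnorm (mul_mem hu ν.2) huν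
    obtain ⟨k, hk, c, hc, hkc⟩ := hKρ ν ν.2 hρν
    obtain ⟨t, ht, het⟩ := hπγ
    have hx : γ * d + ν * v ∈ O4 := add_mem (mul_mem hγ hd) (mul_mem ν.2 hv)
    refine ⟨(⟨(r, k), Finset.mem_product.mpr ⟨hr, hk⟩⟩,
      ⟨c - r - (γ * d + ν * v) * t, sub_mem (sub_mem hc (hO _)) (mul_mem hx ht)⟩), ?_⟩
    apply Subtype.ext
    simp only [Φ]
    linear_combination (π * (γ * d + ν * v)) * het - π * hkc + (π - 1) * (γ * hrd - ν * e)
  rw [← hinj.tsum_eq hsupp]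
  have hterm (j : J) (w : O4) : χ (Φ (j, w)) * ρ (Φ (j, w)) * heckeTerm s (Φ (j, w))
      = χ γ * heckeTerm s (γ * π) * (χ (j.1.1 : ℕ) * ρ j.1.2 *
        heckeTerm s ((j.1.1 : ℂ) / π + j.1.2 / γ + w)) := by
    rw [hχ.periodic _ (Φ (j, w)).2 _ (mul_mem hγ (hO _)) (hΦπ _), hχ.map_mul _ hγ _ (hO _),
      hρ _ (Φ (j, w)).2 _ (hJK _) (hΦγ _)]
    have : (Φ (j, w) : ℂ) = γ * π * ((j.1.1 : ℂ) / π + j.1.2 / γ + w) := by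
      simp only [Φ]
      field_simp
    rw [this, heckeTerm_mul]
    ring
  have hsum (j : J) : Summable fun w : O4 ↦
      χ (Φ (j, w)) * ρ (Φ (j, w)) * heckeTerm s (Φ (j, w)) := by
    simp only [hterm]
    exact ((summable_heckeTerm_add hs _).mul_left _).mul_left _
  have hsum' : Summable fun x : J × O4 ↦ χ (Φ x) * ρ (Φ x) * heckeTerm s (Φ x) :=
    .of_norm ((summable_prod_of_nonneg fun _ ↦ norm_nonneg _).mpr
      ⟨fun j ↦ (hsum j).norm, .of_finite⟩)
  rw [hsum'.tsum_prod' hsum, tsum_fintype, Finset.mul_sum, ← Finset.sum_coe_sort J]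
  refine Finset.sum_congr rfl fun j _ ↦ ?_
  simp only [hterm, tsum_mul_left]

theorem value_one_eq_sum_Z4 (hp : p.Prime) (hπ : π ∈ O4)
    (hnorm : (p : ℂ) = π * (starRingEnd ℂ) π) (hχ : IsResChar4 π χ) (hγ : γ ∈ O4) (hγ0 : γ ≠ 0)
    (hπγ : GCong π 1 γ) (hρ : ∀ a ∈ O4, ∀ b ∈ O4, GCong a b γ → ρ a = ρ b)
    (hK : ∀ k ∈ K, k ∈ O4) (hKρ : ∀ x ∈ O4, ρ x ≠ 0 → ∃ k ∈ K, GCong x k γ)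
    (hKinj : ∀ k ∈ K, ∀ k' ∈ K, GCong k k' γ → k = k') {L : ℂ}
    (hL : IsLValue4 (fun ν ↦ χ ν * ρ ν) L) :
    (varpi : ℂ)⁻¹ * L = 1 / 4 * χ γ * (γ * π)⁻¹ *
      ∑ r ∈ Finset.Icc 1 (p - 1), χ (r : ℕ) * ∑ k ∈ K, ρ k * Z4 ((r : ℂ) / π + k / γ) := by
  obtain ⟨F, hF, hFs, rfl⟩ := hL
  have hv := varpi_ne_zero
  rw [value_one_of_eq_tsum_heckeTerm (Finset.Icc 1 (p - 1) ×ˢ K) (fun j ↦ χ (j.1 : ℕ) * ρ j.2)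
    (fun j ↦ (j.1 : ℂ) / π + j.2 / γ) (1 / 4 * χ γ) (γ * π) hF fun s hs ↦ ?_]
  · rw [Finset.sum_product, mul_left_comm]
    congr 1
    rw [Finset.mul_sum]
    refine Finset.sum_congr rfl fun r _ ↦ ?_
    rw [Finset.mul_sum, Finset.mul_sum]
    refine Finset.sum_congr rfl fun k _ ↦ ?_
    field_simp
  · rw [hFs s hs, mul_assoc (1 / 4), mul_assoc (1 / 4),
      ← tsum_residue_decomposition hp hπ hnorm hχ hγ hγ0 hπγ hρ hK hKρ hKinj hs]
    simp only [heckeTerm, mul_assoc]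

end ResidueDecomposition

section QuarticCharacter

variable {p : ℕ} {π : ℂ} {χ : ℂ → ℂ}

lemma not_dvd_four (hp : p.Prime) (hp4 : p % 4 = 1) : ¬ (p : ℤ) ∣ 4 := by
  intro h
  have h4 : p ∣ 2 ^ 2 := by exact_mod_cast h
  have := (Nat.prime_dvd_prime_iff_eq hp Nat.prime_two).mp (hp.dvd_of_dvd_pow h4)
  lia

lemma four_mul_div_ne (hp : p.Prime) (hp4 : p % 4 = 1)
    (hnorm : (p : ℂ) = π * (starRingEnd ℂ) π) {r : ℕ} (hr : r ∈ Finset.Icc 1 (p - 1))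
    (m n : ℤ) : 4 * ((r : ℂ) / π) ≠ m + n * I := by
  intro h
  have hπ0 := prime_ne_zero hp hnorm
  have hc : GCong ((4 * r : ℤ) : ℂ) ((0 : ℤ) : ℂ) π := by
    refine ⟨m + n * I, mem_O4.mpr ⟨m, n, rfl⟩, ?_⟩
    rw [← h]
    push_cast
    field_simp
    ring
  have := hc.dvd hp hnorm
  rw [sub_zero] at this
  rcases (Nat.prime_iff_prime_int.mp hp).dvd_or_dvd this with h | h
  · exact not_dvd_four hp hp4 h
  · exact not_dvd_of_mem_Icc hr (by exact_mod_cast h)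

lemma coprime_one_add_I (h : GCong π 1 ((1 + I) ^ 3)) : GCoprime (1 + I) π := by
  obtain ⟨u, hu, v, hv, e⟩ := coprime_of_gcong_one h
  exact ⟨u * (1 + I) ^ 2, mul_mem hu (pow_mem (add_mem (one_mem _) I_mem_O4) 2), v, hv,
    by linear_combination e⟩

/-- Fourth roots of unity are distinct modulo a prime of norm different from `2`. -/
lemma eq_of_gcong_of_pow_four (hp : p.Prime) (hp4 : p % 4 = 1)
    (hnorm : (p : ℂ) = π * (starRingEnd ℂ) π) {ε δ : ℂ} (hδ : δ ∈ O4) (hε : ε ∈ O4)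
    (hε4 : ε ^ 4 = 1) (hδ4 : δ ^ 4 = 1) (h : GCong ε δ π) : ε = δ := by
  obtain ⟨d, hd, h⟩ := h
  by_contra hne
  have hg : (ε - δ) * (ε ^ 3 + ε ^ 2 * δ + ε * δ ^ 2 + δ ^ 3) = 0 := by
    linear_combination hε4 - hδ4
  have hg := (mul_eq_zero.mp hg).resolve_left (sub_ne_zero.mpr hne)
  have hc : GCong ((4 : ℤ) : ℂ) ((0 : ℤ) : ℂ) π := by
    refine ⟨-d * (3 * δ ^ 2 + 2 * ε * δ + ε ^ 2) * δ, ?_, ?_⟩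
    · have h3 : (3 : ℂ) ∈ O4 := natCast_mem O4 3
      have h2 : (2 : ℂ) ∈ O4 := natCast_mem O4 2
      exact mul_mem (mul_mem (neg_mem hd) (add_mem (add_mem (mul_mem h3 (pow_mem hδ 2))
        (mul_mem (mul_mem h2 hε) hδ)) (pow_mem hε 2))) hδ
    · push_cast
      linear_combination (-4) * hδ4 - (3 * δ ^ 2 + 2 * ε * δ + ε ^ 2) * δ * h + δ * hg
  have := hc.dvd hp hnorm
  exact not_dvd_four hp hp4 (by simpa using this)

lemma IsQuarticChar.apply_I (hχ : IsQuarticChar π p χ) (hp : p.Prime) (hp4 : p % 4 = 1)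
    (hnorm : (p : ℂ) = π * (starRingEnd ℂ) π) (hπ : π ∈ O4) : χ I = I ^ ((p - 1) / 4) := by
  have hI : GCoprime I π := ⟨-I, neg_mem I_mem_O4, 0, zero_mem _, by simp⟩
  have hpow := pow_mem I_mem_O4 ((p - 1) / 4)
  have he := hχ.euler I I_mem_O4 hI
  refine eq_of_gcong_of_pow_four hp hp4 hnorm hpow ?_ (hχ.quart I I_mem_O4 hI) ?_ he
  · obtain ⟨d, hd, h⟩ := he
    rw [sub_eq_iff_eq_add.mp h]
    exact add_mem (mul_mem hπ hd) hpow
  · rw [← pow_mul, mul_comm, pow_mul, I_pow_four, one_pow]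

lemma IsQuarticChar.sum_eq_zero (hχ : IsQuarticChar π p χ) (hp : p.Prime) (hp4 : p % 4 = 1)
    (hnorm : (p : ℂ) = π * (starRingEnd ℂ) π) (hπ : π ∈ O4) :
    ∑ r ∈ Finset.Icc 1 (p - 1), χ (r : ℕ) = 0 := by
  have : Fact p.Prime := ⟨hp⟩
  have hp2 := hp.two_le
  obtain ⟨g, hg⟩ := IsCyclic.exists_generator (α := (ZMod p)ˣ)
  have hord : orderOf g = p - 1 := by
    rw [orderOf_eq_card_of_forall_mem_zpowers hg, Nat.card_eq_fintype_card, ZMod.card_units]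
  have hgne : g ^ ((p - 1) / 4) ≠ 1 :=
    pow_ne_one_of_lt_orderOf (by lia) (by rw [hord]; lia)
  set a : ℕ := (g : ZMod p).val
  have ha : ((a : ℕ) : ZMod p) = g := ZMod.natCast_zmod_val _
  have hac : GCoprime (a : ℂ) π := by
    refine coprime_natCast hp hπ hnorm fun h ↦ g.ne_zero ?_
    rw [← ha]
    exact (ZMod.natCast_eq_zero_iff _ _).mpr h
  have haO : (a : ℂ) ∈ O4 := natCast_mem _ a
  have hχa : χ a ≠ 1 := by
    intro h
    have he := hχ.euler a haO hac
    rw [h] at he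
    have hd : (p : ℤ) ∣ (1 : ℤ) - (a ^ ((p - 1) / 4) : ℤ) :=
      GCong.dvd hp hnorm (by push_cast; exact he)
    rw [← ZMod.intCast_zmod_eq_zero_iff_dvd] at hd
    push_cast at hd
    rw [ha] at hd
    exact hgne (Units.ext (by push_cast; exact (sub_eq_zero.mp hd).symm))
  have hs := sum_mul_eq hp hπ hnorm haO hac χ hχ.resChar.periodic
  simp only [hχ.resChar.map_mul _ haO _ (natCast_mem O4 _)] at hs
  rw [← Finset.mul_sum] at hs
  have : (χ a - 1) * ∑ r ∈ Finset.Icc 1 (p - 1), χ (r : ℕ) = 0 := by linear_combination hs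
  exact (mul_eq_zero.mp this).resolve_left (sub_ne_zero.mpr hχa)

lemma IsQuarticChar.sum_mul_affine (hχ : IsQuarticChar π p χ) (hp : p.Prime) (hp4 : p % 4 = 1)
    (hnorm : (p : ℂ) = π * (starRingEnd ℂ) π) (hπ : π ∈ O4) {f g : ℂ → ℂ} {c a : ℂ}
    (h : ∀ z, (∀ m n : ℤ, 4 * z ≠ m + n * I) → f z = c + a * g z) :
    ∑ r ∈ Finset.Icc 1 (p - 1), χ (r : ℕ) * f ((r : ℂ) / π)
      = a * ∑ r ∈ Finset.Icc 1 (p - 1), χ (r : ℕ) * g ((r : ℂ) / π) := by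
  have : ∑ r ∈ Finset.Icc 1 (p - 1), χ (r : ℕ) * f ((r : ℂ) / π)
      = ∑ r ∈ Finset.Icc 1 (p - 1), (c * χ (r : ℕ) + a * (χ (r : ℕ) * g ((r : ℂ) / π))) :=
    Finset.sum_congr rfl fun r hr ↦ by
      rw [h _ (four_mul_div_ne hp hp4 hnorm hr)]
      ring
  rw [this, Finset.sum_add_distrib, ← Finset.mul_sum, ← Finset.mul_sum,
    hχ.sum_eq_zero hp hp4 hnorm hπ, mul_zero, zero_add]

lemma psi4_add_of_mem_O4 (z : ℂ) {d : ℂ} (hd : d ∈ O4) : psi4 (z + d) = psi4 z := by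
  have hmem : (varpi : ℂ) * d ∈ lemPair.lattice := by
    obtain ⟨m, n, rfl⟩ := mem_O4.mp hd
    exact (mem_sqPair (ht := varpi_pos)).mpr ⟨m, n, rfl⟩
  have : wp4 (varpi * (z + d)) = wp4 (varpi * z) := by
    rw [wp4_eq, wp4_eq, mul_add]
    exact lemPair.weierstrassP_add_coe _ ⟨_, hmem⟩
  rw [psi4, psi4, this]

lemma IsQuarticChar.mul_sum_psi4_I_mul (hχ : IsQuarticChar π p χ) (hp : p.Prime)
    (hnorm : (p : ℂ) = π * (starRingEnd ℂ) π) (hπ : π ∈ O4) :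
    χ I * ∑ r ∈ Finset.Icc 1 (p - 1), χ (r : ℕ) * psi4 (I * ((r : ℂ) / π))
      = ∑ r ∈ Finset.Icc 1 (p - 1), χ (r : ℕ) * psi4 ((r : ℂ) / π) := by
  have hI : GCoprime I π := ⟨-I, neg_mem I_mem_O4, 0, zero_mem _, by simp⟩
  rw [← sum_mul_eq hp hπ hnorm I_mem_O4 hI (fun x ↦ χ x * psi4 (x / π)), Finset.mul_sum]
  · refine Finset.sum_congr rfl fun r _ ↦ ?_
    rw [hχ.resChar.map_mul _ I_mem_O4 _ (natCast_mem O4 r), mul_div_assoc, mul_assoc]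
  · intro a ha b hb h
    simp only [hχ.resChar.periodic a ha b hb h]
    obtain ⟨d, hd, h⟩ := h
    have hπ0 := prime_ne_zero hp hnorm
    rw [show a / π = b / π + d by field_simp; linear_combination h, psi4_add_of_mem_O4 _ hd]

lemma IsQuarticChar.apply_one_add_I_cube (hχ : IsQuarticChar π p χ)
    (h : GCong π 1 ((1 + I) ^ 3)) : χ ((1 + I) ^ 3) = (starRingEnd ℂ) (χ (1 + I)) := by
  have hO : 1 + I ∈ O4 := add_mem (one_mem _) I_mem_O4
  have h4 := hχ.quart _ hO (coprime_one_add_I h)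
  rw [← inv_eq_conj (norm_eq_one_of_pow_eq_one h4 four_ne_zero), pow_succ, pow_two,
    hχ.resChar.map_mul _ (mul_mem hO hO) _ hO, hχ.resChar.map_mul _ hO _ hO]
  exact eq_inv_of_mul_eq_one_left (by linear_combination h4)

end QuarticCharacter

section EvenModuli

lemma odd_of_coprime {m n : ℤ} {γ δ : ℂ} (hδ : δ ∈ O4) (hγ : γ = (1 + I) * δ)
    (h : GCoprime (m + n * I) γ) : (m + n) % 2 = 1 := by
  obtain ⟨u, hu, v, hv, e⟩ := h
  by_contra hmn
  obtain ⟨k, hk⟩ : ∃ k, m = 2 * k - n := ⟨(m + n) / 2, by lia⟩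
  have hc (k : ℤ) : (k : ℂ) ∈ O4 := intCast_mem _ k
  have ht : u * (k * (1 - I) + n * I) + v * δ ∈ O4 :=
    add_mem (mul_mem hu (add_mem (mul_mem (hc _) (sub_mem (one_mem _) I_mem_O4))
      (mul_mem (hc _) I_mem_O4))) (mul_mem hv hδ)
  obtain ⟨a, b, hab⟩ := mem_O4.mp ht
  have h1 : (1 + I) * (a + b * I) = 1 := by
    rw [hγ, hk] at e
    push_cast at e
    linear_combination e - (1 + I) * hab + (u * n - u * k) * I_sq
  have hre := congrArg re h1
  have him := congrArg im h1
  simp at hre him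
  norm_cast at hre him
  lia

lemma exists_gcong_two {x : ℂ} (hx : x ∈ O4) (h : GCoprime x 2) :
    ∃ k ∈ ({1, I} : Finset ℂ), GCong x k 2 := by
  obtain ⟨m, n, rfl⟩ := mem_O4.mp hx
  have hodd := odd_of_coprime (sub_mem (one_mem _) I_mem_O4)
    (show (2 : ℂ) = (1 + I) * (1 - I) by linear_combination I_sq) h
  rcases Int.emod_two_eq_zero_or_one m with hm | hm
  · obtain ⟨a, ha⟩ : ∃ a, m = 2 * a := ⟨m / 2, by lia⟩
    obtain ⟨b, hb⟩ : ∃ b, n = 2 * b + 1 := ⟨n / 2, by lia⟩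
    refine ⟨I, by simp, a + b * I, mem_O4.mpr ⟨a, b, rfl⟩, ?_⟩
    rw [ha, hb]
    push_cast
    ring
  · obtain ⟨a, ha⟩ : ∃ a, m = 2 * a + 1 := ⟨m / 2, by lia⟩
    obtain ⟨b, hb⟩ : ∃ b, n = 2 * b := ⟨n / 2, by lia⟩
    refine ⟨1, by simp, a + b * I, mem_O4.mpr ⟨a, b, rfl⟩, ?_⟩
    rw [ha, hb]
    push_cast
    ring

lemma one_add_I_cube : (1 + I) ^ 3 = -2 + 2 * I := by
  linear_combination (3 + I) * I_sq

lemma gcong_cube {m n m' n' a b : ℤ} (hm : m - m' = -2 * (a + b)) (hn : n - n' = 2 * (a - b)) :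
    GCong (m + n * I) (m' + n' * I) ((1 + I) ^ 3) := by
  refine ⟨a + b * I, mem_O4.mpr ⟨a, b, rfl⟩, ?_⟩
  have hm' : (m - m' : ℂ) = -2 * (a + b) := by exact_mod_cast hm
  have hn' : (n - n' : ℂ) = 2 * (a - b) := by exact_mod_cast hn
  rw [one_add_I_cube]
  linear_combination hm' + I * hn' - 2 * b * I_sq

lemma exists_gcong_cube {x : ℂ} (hx : x ∈ O4) (h : GCoprime x ((1 + I) ^ 3)) :
    ∃ k ∈ ({1, -1, I, -I} : Finset ℂ), GCong x k ((1 + I) ^ 3) := by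
  obtain ⟨m, n, rfl⟩ := mem_O4.mp hx
  have hodd := odd_of_coprime (pow_mem (add_mem (one_mem _) I_mem_O4) 2) (by ring) h
  have key (m' n' : ℤ) (h1 : (m - m') % 2 = 0) (h2 : (m - m' + (n - n')) % 4 = 0) :
      GCong (m + n * I) (m' + n' * I) ((1 + I) ^ 3) :=
    gcong_cube (a := (n - n' - (m - m')) / 4) (b := -(n - n' + (m - m')) / 4)
      (by lia) (by lia)
  rcases Int.emod_two_eq_zero_or_one m with hm | hm
  · rcases (by lia : (m + n) % 4 = 1 ∨ (m + n) % 4 = 3) with h4 | h4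
    · exact ⟨I, by simp, by simpa using key 0 1 (by lia) (by lia)⟩
    · exact ⟨-I, by simp, by simpa using key 0 (-1) (by lia) (by lia)⟩
  · rcases (by lia : (m + n) % 4 = 1 ∨ (m + n) % 4 = 3) with h4 | h4
    · exact ⟨1, by simp, by simpa using key 1 0 (by lia) (by lia)⟩
    · exact ⟨-1, by simp, by simpa using key (-1) 0 (by lia) (by lia)⟩

lemma GCong.of_cube {a b : ℂ} (h : GCong a b ((1 + I) ^ 3)) : GCong a b 2 := by
  obtain ⟨d, hd, h⟩ := h
  exact ⟨(-1 + I) * d, mul_mem (add_mem (neg_mem (one_mem _)) I_mem_O4) hd, by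
    rw [h, one_add_I_cube]; ring⟩

lemma sum_four_units (f : ℂ → ℂ) :
    ∑ k ∈ ({1, -1, I, -I} : Finset ℂ), f k = f 1 + f (-1) + f I + f (-I) := by
  have h1 : (1 : ℂ) ∉ ({-1, I, -I} : Finset ℂ) := by
    simp [Complex.ext_iff]; norm_num
  have h2 : (-1 : ℂ) ∉ ({I, -I} : Finset ℂ) := by simp [Complex.ext_iff]
  have h3 : I ∉ ({-I} : Finset ℂ) := by simp [Complex.ext_iff]; norm_num
  rw [Finset.sum_insert h1, Finset.sum_insert h2, Finset.sum_insert h3, Finset.sum_singleton]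
  ring

lemma sum_one_I (f : ℂ → ℂ) : ∑ k ∈ ({1, I} : Finset ℂ), f k = f 1 + f I :=
  Finset.sum_pair (by simp [Complex.ext_iff])

end EvenModuli

section MainCases

variable {p : ℕ} {π : ℂ} {χ χ₀ : ℂ → ℂ}

lemma value_one_mod_cube (hp : p.Prime) (hπ : π ∈ O4)
    (hprimary : GCong π 1 ((1 + I) ^ 3)) (hnorm : (p : ℂ) = π * (starRingEnd ℂ) π)
    (hχ : IsQuarticChar π p χ) (hχ₀ : IsChi0₄ χ₀) (τ : ℂ → ℂ) (hτ0 : τ 0 = 0)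
    {L : ℂ} (hL : IsLValue4 (fun ν ↦ χ ν * τ (χ₀ ν)) L) :
    (varpi : ℂ)⁻¹ * L = 1 / 4 * (starRingEnd ℂ) (χ (1 + I)) * ((-2 + 2 * I) * π)⁻¹ *
      ∑ r ∈ Finset.Icc 1 (p - 1), χ (r : ℕ) *
        (τ 1 * Z4 ((r : ℂ) / π - (1 + I) / 4) + τ (-1) * Z4 ((r : ℂ) / π + (1 + I) / 4)
          + τ I * Z4 ((r : ℂ) / π - I * ((1 + I) / 4))
          + τ (-I) * Z4 ((r : ℂ) / π + I * ((1 + I) / 4))) := by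
  have hO : 1 + I ∈ O4 := add_mem (one_mem _) I_mem_O4
  have hI0 : -2 + 2 * I ≠ 0 := by simp [Complex.ext_iff]
  have hper := hχ₀.1.periodic
  have hunits (k : ℂ) (hk : k ∈ ({1, -1, I, -I} : Finset ℂ)) : χ₀ k = k :=
    hχ₀.2 k (by simpa using hk)
  have hunitsO (k : ℂ) (hk : k ∈ ({1, -1, I, -I} : Finset ℂ)) : k ∈ O4 := by
    simp only [Finset.mem_insert, Finset.mem_singleton] at hk
    rcases hk with rfl | rfl | rfl | rfl
    exacts [one_mem _, neg_mem (one_mem _), I_mem_O4, neg_mem I_mem_O4]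
  rw [value_one_eq_sum_Z4 (γ := (1 + I) ^ 3) (K := {1, -1, I, -I}) hp hπ hnorm hχ.resChar
    (pow_mem hO 3) (by rwa [one_add_I_cube]) hprimary
    (fun a ha b hb h ↦ congrArg τ (hper a ha b hb h)) hunitsO ?_ ?_ hL,
    hχ.apply_one_add_I_cube hprimary, one_add_I_cube]
  · congr 1
    refine Finset.sum_congr rfl fun r _ ↦ ?_
    have hinv (k : ℂ) : k / (-2 + 2 * I) = -(k * ((1 + I) / 4)) := by
      rw [div_eq_iff hI0]
      linear_combination k / 2 * I_sq
    rw [sum_four_units, hunits 1 (by simp), hunits (-1) (by simp), hunits I (by simp),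
      hunits (-I) (by simp)]
    simp only [hinv]
    ring_nf
  · intro x hx h
    refine exists_gcong_cube hx (by_contra fun hc ↦ h ?_)
    rw [hχ₀.1.vanish x hx hc, hτ0]
  · intro k hk k' hk' h
    rw [← hunits k hk, ← hunits k' hk', hper k (hunitsO k hk) k' (hunitsO k' hk') h]

end MainCases

/-- **Theorem II.2.** Let `π ∈ ℤ[i]` be a primary prime with `p = π·π̄` and let `χ̃_π`
be the associated Hecke character of weight one. Then `ϖ⁻¹·L(1, χ̃_π)` equals:
`−((1+i)/2)·χ_π(2)·π⁻¹·G_π(χ_π, φ)` if `p ≡ 13 (mod 16)`; `π⁻¹·G_π(χ_π, Z)` if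
`p ≡ 5 (mod 16)`; `χ̄_π(1+i)·π⁻¹·G_π(χ_π, ψ)` if `p ≡ 1 (mod 16)`; and
`−χ̄_π(1+i)·π⁻¹·G_π(χ_π, ψ)` if `p ≡ 9 (mod 16)`. -/
theorem stmt_12
    (p : ℕ) (hp : p.Prime) (hp4 : p % 4 = 1)
    (π : ℂ) (hπ : π ∈ O4) (hprimary : GCong π 1 ((1 + Complex.I) ^ 3))
    (hnorm : (p : ℂ) = π * (starRingEnd ℂ) π)
    (χ : ℂ → ℂ) (hχ : IsQuarticChar π p χ)
    (χ₀ : ℂ → ℂ) (hχ₀ : IsChi0₄ χ₀)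
    (χ₀' : ℂ → ℂ) (hχ₀' : IsChi0'₄ χ₀') :
    (p % 16 = 13 → ∀ L : ℂ, IsLValue4 (fun ν => χ ν * χ₀' ν) L →
      ((varpi : ℂ))⁻¹ * L
        = -((1 + Complex.I) / 2) * χ 2 * π⁻¹ * EGS4 p χ phi4 π) ∧
    (p % 16 = 5 → ∀ L : ℂ, IsLValue4 χ L →
      ((varpi : ℂ))⁻¹ * L = π⁻¹ * EGS4 p χ Z4 π) ∧
    (p % 16 = 1 → ∀ L : ℂ, IsLValue4 (fun ν => χ ν * χ₀ ν) L →
      ((varpi : ℂ))⁻¹ * L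
        = (starRingEnd ℂ) (χ (1 + Complex.I)) * π⁻¹ * EGS4 p χ psi4 π) ∧
    (p % 16 = 9 → ∀ L : ℂ, IsLValue4 (fun ν => χ ν * (starRingEnd ℂ) (χ₀ ν)) L →
      ((varpi : ℂ))⁻¹ * L
        = -((starRingEnd ℂ) (χ (1 + Complex.I))) * π⁻¹ * EGS4 p χ psi4 π) := by
  have hπ0 := prime_ne_zero hp hnorm
  have hI0 : -2 + 2 * I ≠ 0 := by simp [Complex.ext_iff]
  have hk : (-2 + 2 * I)⁻¹ * (1 - I) = -1 / 2 := by
    rw [inv_mul_eq_iff_eq_mul₀ hI0]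
    ring
  have hperI := hχ.mul_sum_psi4_I_mul hp hnorm hπ
  set S := ∑ r ∈ Finset.Icc 1 (p - 1), χ (r : ℕ) * psi4 ((r : ℂ) / π)
  set T := ∑ r ∈ Finset.Icc 1 (p - 1), χ (r : ℕ) * psi4 (I * ((r : ℂ) / π))
  refine ⟨fun h16 L hL ↦ ?_, fun h16 L hL ↦ ?_, fun h16 L hL ↦ ?_, fun h16 L hL ↦ ?_⟩
  · have h2O : (2 : ℂ) ∈ O4 := natCast_mem O4 2
    have hper := hχ₀'.1.periodic
    obtain ⟨c, hc⟩ := Z4_sub_half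
    rw [value_one_eq_sum_Z4 (γ := 2) (K := {1, I}) hp hπ hnorm hχ.resChar h2O two_ne_zero
      hprimary.of_cube hper ?_ ?_ ?_ hL]
    · have h := hχ.sum_mul_affine hp hp4 hnorm hπ
        (f := fun z ↦ Z4 (z + 1 / 2) - Z4 (z + I / 2)) (g := phi4) (c := c) (a := -(1 + I))
        fun z hz ↦ by rw [hc z hz]; ring
      simp only [sum_one_I, hχ₀'.1.map_one, hχ₀'.2, one_mul, neg_one_mul, ← sub_eq_add_neg]
      rw [h, EGS4]
      field_simp
    · intro k hk
      simp only [Finset.mem_insert, Finset.mem_singleton] at hk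
      rcases hk with rfl | rfl
      exacts [one_mem _, I_mem_O4]
    · exact fun x hx h ↦ exists_gcong_two hx (by_contra fun hc ↦ h (hχ₀'.1.vanish x hx hc))
    · have hne : ¬ χ₀' 1 = χ₀' I := by
        rw [hχ₀'.1.map_one, hχ₀'.2]
        norm_num
      intro k hk k' hk' h
      simp only [Finset.mem_insert, Finset.mem_singleton] at hk hk'
      rcases hk with rfl | rfl <;> rcases hk' with rfl | rfl
      · rfl
      · exact absurd (hper _ (one_mem _) _ I_mem_O4 h) hne
      · exact absurd (hper _ I_mem_O4 _ (one_mem _) h).symm hne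
      · rfl
  · have hone (x : ℂ) (hx : x ∈ O4) : GCong x 0 1 := ⟨x, hx, by ring⟩
    rw [value_one_eq_sum_Z4 (γ := 1) (K := {0}) (ρ := fun _ ↦ 1) hp hπ hnorm hχ.resChar
      (one_mem _) one_ne_zero ⟨π - 1, sub_mem hπ (one_mem _), by ring⟩ (fun _ _ _ _ _ ↦ rfl)
      (by simp) (fun x hx _ ↦ ⟨0, by simp, hone x hx⟩) (by simp) (by simpa using hL), EGS4,
      hχ.resChar.map_one]
    simp only [Finset.sum_singleton, zero_div, add_zero, one_mul]
    ring
  · obtain ⟨c, hc⟩ := Z4_quartic_sum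
    have h := hχ.sum_mul_affine hp hp4 hnorm hπ (c := c) (a := -(1 - I))
      (g := fun z ↦ psi4 z + psi4 (I * z))
      (f := fun z ↦ id 1 * Z4 (z - (1 + I) / 4) + id (-1) * Z4 (z + (1 + I) / 4)
        + id I * Z4 (z - I * ((1 + I) / 4)) + id (-I) * Z4 (z + I * ((1 + I) / 4)))
      fun z hz ↦ by
        simp only [id]
        linear_combination hc z hz
    rw [value_one_mod_cube hp hπ hprimary hnorm hχ hχ₀ id rfl hL]
    refine (congrArg _ h).trans ?_
    have hχI : χ I = 1 := by
      rw [hχ.apply_I hp hp4 hnorm hπ, show (p - 1) / 4 = 4 * ((p - 1) / 16) by lia, pow_mul,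
        I_pow_four, one_pow]
    rw [hχI] at hperI
    simp only [mul_add, Finset.sum_add_distrib, EGS4, mul_inv]
    linear_combination (starRingEnd ℂ) (χ (1 + I)) * π⁻¹ / 8 * hperI
      - (starRingEnd ℂ) (χ (1 + I)) / 4 * π⁻¹ * (S + T) * hk
  · obtain ⟨c, hc⟩ := Z4_conj_quartic_sum
    have h := hχ.sum_mul_affine hp hp4 hnorm hπ (c := c) (a := 1 - I)
      (g := fun z ↦ psi4 z - psi4 (I * z))
      (f := fun z ↦ starRingEnd ℂ 1 * Z4 (z - (1 + I) / 4)
        + starRingEnd ℂ (-1) * Z4 (z + (1 + I) / 4)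
        + starRingEnd ℂ I * Z4 (z - I * ((1 + I) / 4))
        + starRingEnd ℂ (-I) * Z4 (z + I * ((1 + I) / 4)))
      fun z hz ↦ by
        simp only [map_one, map_neg, conj_I]
        linear_combination hc z hz
    rw [value_one_mod_cube hp hπ hprimary hnorm hχ hχ₀ (starRingEnd ℂ) (map_zero _) hL]
    refine (congrArg _ h).trans ?_
    have hχI : χ I = -1 := by
      rw [hχ.apply_I hp hp4 hnorm hπ, show (p - 1) / 4 = 4 * ((p - 1) / 16) + 2 by lia, pow_add,
        pow_mul, I_pow_four, one_pow, one_mul, I_sq]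
    rw [hχI] at hperI
    simp only [mul_sub, Finset.sum_sub_distrib, EGS4, mul_inv]
    linear_combination (starRingEnd ℂ) (χ (1 + I)) / 4 * π⁻¹ * (S - T) * hk
      - (starRingEnd ℂ) (χ (1 + I)) * π⁻¹ / 8 * hperI

end
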